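/- arXiv:0804.0923 — 5 statements merged into one kernel-verified Lean document; each statement's English description precedes it below -/
import Mathlib

section
/- Let A be a ring and (C^{p,q})_{p,q∈ℤ} a double complex of A-modules. Assume that either (1) there exists N ∈ ℤ with C^{p,q} = 0 for all p > N, or (2) there exists N ∈ ℤ with C^{p,q} = 0 for all q < N. If for every p the column complex (C^{p,•}, d″) is acyclic, then the total complex Tot(C), with Tot(C)^n = ⊕_{p+q=n} C^{p,q} and differential d′ + d″, is acyclic. -/
open CategoryTheory Limits

namespace TotAcyc

universe v

variable {A : Type} [Ring A]
  (C : HomologicalComplex₂ (ModuleCat.{v} A) (ComplexShape.up ℤ) (ComplexShape.up ℤ))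
  [C.HasTotal (ComplexShape.up ℤ)]

/-- Inclusion of a summand. -/
noncomputable def J (p q n : ℤ) (h : p + q = n) :
    (C.X p).X q →ₗ[A] (C.total (ComplexShape.up ℤ)).X n :=
  (C.ιTotal (ComplexShape.up ℤ) p q n h).hom

/-- The differential of the total complex. -/
noncomputable def D (n m : ℤ) :
    (C.total (ComplexShape.up ℤ)).X n →ₗ[A] (C.total (ComplexShape.up ℤ)).X m :=
  ((C.total (ComplexShape.up ℤ)).d n m).hom

/-- The sign. -/
def sg (p : ℤ) : ℤ := ((ComplexShape.up ℤ).ε p : ℤˣ)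

lemma sg_mul (p : ℤ) : sg p * sg p = 1 := by
  unfold sg
  rw [← Units.val_mul, Int.units_mul_self]; rfl

lemma D_J (p q n : ℤ) (h : p + q = n) (p' q' m : ℤ) (hp : p + 1 = p') (hq : q + 1 = q')
    (hm : n + 1 = m) (a : (C.X p).X q) :
    D C n m (J C p q n h a) = J C p' q m (by lia) ((C.d p p').f q a)
      + sg p • J C p q' m (by lia) ((C.X p).d q q' a) := by
  have h1 : C.ιTotal (ComplexShape.up ℤ) p q n h ≫ (C.total (ComplexShape.up ℤ)).d n m =
      (C.d p p').f q ≫ C.ιTotal (ComplexShape.up ℤ) p' q m (show p' + q = m by lia)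
      + sg p • ((C.X p).d q q' ≫ C.ιTotal (ComplexShape.up ℤ) p q' m (show p + q' = m by lia)) := by
    rw [HomologicalComplex₂.total_d, Preadditive.comp_add, C.ι_D₁, C.ι_D₂,
      C.d₁_eq (ComplexShape.up ℤ) (i₁ := p) (i₁' := p') hp q m (show p' + q = m by lia),
      C.d₂_eq (ComplexShape.up ℤ) p (i₂ := q) (i₂' := q') hq m (show p + q' = m by lia)]
    congr 1
    exact one_smul _ _
  have h2 := congrArg (fun f => f.hom a) h1
  exact h2

/-- Projection to a summand. -/
noncomputable def P (p q n : ℤ) :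
    (C.total (ComplexShape.up ℤ)).X n →ₗ[A] (C.X p).X q :=
  (C.totalDesc (c₁₂ := ComplexShape.up ℤ) (i₁₂ := n)
    (fun i j _ => if hh : i = p ∧ j = q then (C.XXIsoOfEq _ _ _ hh.1 hh.2).hom else 0)).hom

lemma P_J_self (p q n : ℤ) (h : p + q = n) (a : (C.X p).X q) :
    P C p q n (J C p q n h a) = a := by
  have := C.ι_totalDesc (c₁₂ := ComplexShape.up ℤ) (i₁₂ := n)
    (fun i j _ => if hh : i = p ∧ j = q then (C.XXIsoOfEq _ _ _ hh.1 hh.2).hom else 0) p q h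
  have h2 := congrArg (fun f => f.hom a) this
  refine Eq.trans h2 ?_
  simp

lemma P_J_ne (p q n : ℤ) (i j : ℤ) (h : i + j = n) (hi : i ≠ p) (a : (C.X i).X j) :
    P C p q n (J C i j n h a) = 0 := by
  have := C.ι_totalDesc (c₁₂ := ComplexShape.up ℤ) (i₁₂ := n)
    (fun i j _ => if hh : i = p ∧ j = q then (C.XXIsoOfEq _ _ _ hh.1 hh.2).hom else 0) i j h
  have h2 := congrArg (fun f => f.hom a) this
  refine Eq.trans h2 ?_
  simp [hi]

/-- The filtration by columns. -/
noncomputable def F (p₀ n : ℤ) : Submodule A ((C.total (ComplexShape.up ℤ)).X n) :=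
  ⨆ x : {x : ℤ × ℤ // x.1 + x.2 = n ∧ p₀ ≤ x.1}, LinearMap.range (J C x.1.1 x.1.2 n x.2.1)

lemma J_mem (p₀ p q n : ℤ) (h : p + q = n) (hp : p₀ ≤ p) (a : (C.X p).X q) :
    J C p q n h a ∈ F C p₀ n :=
  (le_iSup (fun x : {x : ℤ × ℤ // x.1 + x.2 = n ∧ p₀ ≤ x.1} =>
    LinearMap.range (J C x.1.1 x.1.2 n x.2.1)) ⟨(p, q), h, hp⟩) ⟨a, rfl⟩

lemma F_le (p₀ n : ℤ) (S : Submodule A ((C.total (ComplexShape.up ℤ)).X n))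
    (hS : ∀ p q h, p₀ ≤ p → ∀ a, J C p q n h a ∈ S) : F C p₀ n ≤ S := by
  refine iSup_le ?_
  rintro ⟨⟨p, q⟩, h, hp⟩ _ ⟨a, rfl⟩
  exact hS p q h hp a

lemma F_anti (n : ℤ) {p p' : ℤ} (h : p ≤ p') : F C p' n ≤ F C p n :=
  F_le C _ _ _ fun _ _ h' hp a => J_mem C _ _ _ _ h' (h.trans hp) a

lemma exists_mem_F (n : ℤ) (z : (C.total (ComplexShape.up ℤ)).X n) : ∃ p, z ∈ F C p n := by
  have hdir : Directed (· ≤ ·) (fun p => F C p n) := fun a b =>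
    ⟨min a b, F_anti C n (min_le_left _ _), F_anti C n (min_le_right _ _)⟩
  rw [← Submodule.mem_iSup_of_directed _ hdir]
  have h0 : ModuleCat.ofHom (⨆ p, F C p n).mkQ = 0 := by
    refine HomologicalComplex₂.total.hom_ext (K := C) (c₁₂ := ComplexShape.up ℤ) (i₁₂ := n) ?_
    intro p q h
    ext a
    have : J C p q n h a ∈ ⨆ p, F C p n :=
      (le_iSup (fun p => F C p n) p) (J_mem C p p q n h le_rfl a)
    exact (Submodule.Quotient.mk_eq_zero _).2 this
  have h1 := congrArg (fun f => f.hom z) h0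
  exact (Submodule.Quotient.mk_eq_zero _).1 h1

lemma F_decomp (p₀ q₀ n : ℤ) (h : p₀ + q₀ = n) (z : (C.total (ComplexShape.up ℤ)).X n)
    (hz : z ∈ F C p₀ n) : ∃ a, z - J C p₀ q₀ n h a ∈ F C (p₀ + 1) n := by
  have : F C p₀ n ≤ LinearMap.range (J C p₀ q₀ n h) ⊔ F C (p₀ + 1) n := by
    refine F_le C _ _ _ fun p q h' hp a => ?_
    rcases hp.eq_or_lt with rfl | hp
    · obtain rfl : q = q₀ := by lia
      exact Submodule.mem_sup_left ⟨a, rfl⟩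
    · exact Submodule.mem_sup_right (J_mem C _ _ _ _ _ (by lia) a)
  obtain ⟨_, ⟨a, rfl⟩, w, hw, rfl⟩ := Submodule.mem_sup.1 (this hz)
  exact ⟨a, by simpa using hw⟩

lemma D_mem (p₀ n m : ℤ) (hm : n + 1 = m) (z : (C.total (ComplexShape.up ℤ)).X n)
    (hz : z ∈ F C p₀ n) : D C n m z ∈ F C p₀ m := by
  have : F C p₀ n ≤ (F C p₀ m).comap (D C n m) := by
    refine F_le C _ _ _ fun p q h hp a => ?_
    rw [Submodule.mem_comap, D_J C p q n h (p + 1) (q + 1) m rfl rfl hm]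
    exact add_mem (J_mem C _ _ _ _ _ (by lia) _) (zsmul_mem (J_mem C _ _ _ _ _ hp _) _)
  exact this hz

lemma P_F (p₀ q n : ℤ) (z : (C.total (ComplexShape.up ℤ)).X n)
    (hz : z ∈ F C (p₀ + 1) n) : P C p₀ q n z = 0 := by
  have : F C (p₀ + 1) n ≤ LinearMap.ker (P C p₀ q n) :=
    F_le C _ _ _ fun p q' h hp a => P_J_ne C _ _ _ _ _ _ (by lia) a
  exact this hz

lemma D_D (n m k : ℤ) (z) : D C m k (D C n m z) = 0 := by
  have := congrArg (fun f => f.hom z) ((C.total (ComplexShape.up ℤ)).d_comp_d n m k)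
  exact this

lemma main (hcol : ∀ p : ℤ, ∀ i : ℤ, (C.X p).ExactAt i) (l n m M : ℤ) (hl : l + 1 = n)
    (hm : n + 1 = m) (hM : ∀ p q : ℤ, p + q = n → M < p → IsZero ((C.X p).X q)) (k : ℕ) :
    ∀ p₀ : ℤ, M < p₀ + k → ∀ z ∈ F C p₀ n, D C n m z = 0 → ∃ w, D C l n w = z := by
  induction k with
  | zero =>
    intro p₀ hp₀ z hz _
    have : F C p₀ n ≤ ⊥ := F_le C _ _ _ fun p q h hp a => by
      have := ModuleCat.subsingleton_of_isZero (hM p q h (by simp at hp₀; lia))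
      rw [Subsingleton.elim a 0, map_zero]
      exact zero_mem _
    have hz0 : z = 0 := this hz
    exact ⟨0, by rw [map_zero, hz0]⟩
  | succ k ih =>
    intro p₀ hp₀ z hz hDz
    obtain ⟨q₁, hq₁⟩ : ∃ q₁ : ℤ, p₀ + (q₁ + 1) = n := ⟨n - p₀ - 1, by lia⟩
    obtain ⟨a, ha⟩ := F_decomp C p₀ (q₁ + 1) n hq₁ z hz
    have hda : (C.X p₀).d (q₁ + 1) (q₁ + 1 + 1) a = 0 := by
      have h1 := P_F C p₀ (q₁ + 1 + 1) m _ (D_mem C _ n m hm _ ha)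
      rw [map_sub, hDz, zero_sub, map_neg, neg_eq_zero,
        D_J C p₀ (q₁ + 1) n hq₁ (p₀ + 1) (q₁ + 1 + 1) m rfl rfl hm, map_add, map_zsmul,
        P_J_self, P_J_ne C _ _ _ _ _ _ (by lia), zero_add] at h1
      have h2 := congrArg (fun x => sg p₀ • x) h1
      simpa [smul_smul, sg_mul] using h2
    have hex := hcol p₀ (q₁ + 1)
    rw [(C.X p₀).exactAt_iff' q₁ (q₁ + 1) (q₁ + 1 + 1) (by simp) (by simp),
      ShortComplex.moduleCat_exact_iff] at hex
    obtain ⟨y, hy⟩ := hex a hda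
    replace hy : (C.X p₀).d q₁ (q₁ + 1) y = a := hy
    have hDw := D_J C p₀ q₁ l (by lia) (p₀ + 1) (q₁ + 1) n rfl rfl hl y
    rw [hy] at hDw
    have hDw' : D C l n (sg p₀ • J C p₀ q₁ l (by lia) y) =
        sg p₀ • J C (p₀ + 1) q₁ n (by lia) ((C.d p₀ (p₀ + 1)).f q₁ y)
          + J C p₀ (q₁ + 1) n hq₁ a := by
      rw [map_zsmul, hDw, smul_add, smul_smul, sg_mul, one_smul]
    obtain ⟨w, hw⟩ := ih (p₀ + 1) (by push_cast at hp₀; lia)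
      (z - D C l n (sg p₀ • J C p₀ q₁ l (by lia) y)) (by
        rw [hDw', sub_add_eq_sub_sub_swap]
        exact sub_mem ha (zsmul_mem (J_mem C _ _ _ _ _ le_rfl _) _))
      (by rw [map_sub, hDz, D_D, sub_zero])
    exact ⟨w + sg p₀ • J C p₀ q₁ l (by lia) y, by rw [map_add, hw, sub_add_cancel]⟩

end TotAcyc

theorem total_acyclic_of_columns_acyclic
    (A : Type) [Ring A]
    (C : HomologicalComplex₂ (ModuleCat A) (ComplexShape.up ℤ) (ComplexShape.up ℤ))
    [C.HasTotal (ComplexShape.up ℤ)]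
    (hbound : (∃ N : ℤ, ∀ p q : ℤ, N < p → IsZero ((C.X p).X q)) ∨
              (∃ N : ℤ, ∀ p q : ℤ, q < N → IsZero ((C.X p).X q)))
    (hcol : ∀ p : ℤ, ∀ i : ℤ, (C.X p).ExactAt i) :
    ∀ n : ℤ, (C.total (ComplexShape.up ℤ)).ExactAt n := by
  intro n
  obtain ⟨M, hM⟩ : ∃ M : ℤ, ∀ p q : ℤ, p + q = n → M < p → IsZero ((C.X p).X q) := by
    rcases hbound with ⟨N, hN⟩ | ⟨N, hN⟩
    · exact ⟨N, fun p q _ hp => hN p q hp⟩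
    · exact ⟨n - N, fun p q h hp => hN p q (by lia)⟩
  rw [HomologicalComplex.exactAt_iff' _ (n - 1) n (n + 1) (by simp) (by simp),
    ShortComplex.moduleCat_exact_iff]
  intro z hz
  obtain ⟨p₀, hp₀⟩ := TotAcyc.exists_mem_F C n z
  exact TotAcyc.main C hcol (n - 1) n (n + 1) M (by lia) rfl hM (M - p₀ + 1).toNat p₀ (by lia)
    z hp₀ hz
end

section
/- Let A be a ring, let C and C′ be double complexes of A-modules, and let f: C → C′ be a morphism of double complexes (a family of maps f^{p,q}: C^{p,q} → C′^{p,q} commuting with both differentials). Assume that either both C and C′ satisfy: there exists N with zero entries for p > N, or both satisfy: there exists N with zero entries for q < N. If for every p the induced map of column complexes (C^{p,•}, d″) → (C′^{p,•}, d″) is a quasi-isomorphism, then the induced map Tot(C) → Tot(C′) of total complexes is a quasi-isomorphism. -/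
open CategoryTheory Limits

namespace TotQI
universe v
variable {A : Type} [Ring A]

section homology
variable {K L : CochainComplex (ModuleCat.{v} A) ℤ}

lemma exists_cycle {j k : ℤ} (hk : j + 1 = k) (x : K.X j) (hx : K.d j k x = 0) :
    ∃ z : K.cycles j, K.iCycles j z = x := by
  have h := ShortComplex.exact_of_f_is_kernel
    (ShortComplex.mk (K.iCycles j) (K.d j k) (K.iCycles_d j k))
    (K.cyclesIsKernel j k (by simp [hk]))
  exact (ShortComplex.moduleCat_exact_iff _).1 h x hx

lemma exists_boundary {i j : ℤ} (hi : i + 1 = j) (z : K.cycles j) (hz : K.homologyπ j z = 0) :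
    ∃ w : K.X i, K.d i j w = K.iCycles j z := by
  have h := ShortComplex.exact_of_g_is_cokernel
    (ShortComplex.mk (K.toCycles i j) (K.homologyπ j) (K.toCycles_comp_homologyπ i j))
    (K.homologyIsCokernel i j (by simp [← hi]))
  obtain ⟨w, hw⟩ := (ShortComplex.moduleCat_exact_iff _).1 h z hz
  refine ⟨w, ?_⟩
  rw [← hw, ← K.toCycles_i i j]
  rfl

lemma homologyπ_boundary {i j : ℤ} (w : K.X i) (z : K.cycles j)
    (h : K.d i j w = K.iCycles j z) : K.homologyπ j z = 0 := by
  have : K.toCycles i j w = z := by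
    apply (ModuleCat.mono_iff_injective (K.iCycles j)).1 inferInstance
    rw [← h, ← K.toCycles_i i j]
    rfl
  rw [← this]
  exact ConcreteCategory.congr_hom (K.toCycles_comp_homologyπ i j) w

lemma homologyπ_map (g : K ⟶ L) (j : ℤ) (z : K.cycles j) :
    HomologicalComplex.homologyMap g j (K.homologyπ j z) =
      L.homologyπ j (HomologicalComplex.cyclesMap g j z) :=
  ConcreteCategory.congr_hom (HomologicalComplex.homologyπ_naturality g j) z

lemma i_map (g : K ⟶ L) (j : ℤ) (z : K.cycles j) :
    L.iCycles j (HomologicalComplex.cyclesMap g j z) = g.f j (K.iCycles j z) :=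
  ConcreteCategory.congr_hom (HomologicalComplex.cyclesMap_i g j) z

lemma f_d (g : K ⟶ L) (i j : ℤ) (x : K.X i) : g.f j (K.d i j x) = L.d i j (g.f i x) :=
  (ConcreteCategory.congr_hom (g.comm i j) x).symm

lemma d_d (i j k : ℤ) (x : K.X i) : K.d j k (K.d i j x) = 0 :=
  ConcreteCategory.congr_hom (K.d_comp_d i j k) x

lemma d_i (j k : ℤ) (z : K.cycles j) : K.d j k (K.iCycles j z) = 0 :=
  ConcreteCategory.congr_hom (K.iCycles_d j k) z

/-- Element form of acyclicity of the cone. -/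
def ConeAcyclic (g : K ⟶ L) : Prop :=
  ∀ (i j k l : ℤ), i + 1 = j → j + 1 = k → k + 1 = l → ∀ (x : K.X k) (y : L.X j),
    K.d k l x = 0 → g.f k x = L.d j k y →
    ∃ (x' : K.X j) (y' : L.X i), x = K.d j k x' ∧ y = g.f j x' + L.d i j y'

lemma coneAcyclic_of_quasiIso (g : K ⟶ L) [QuasiIso g] : ConeAcyclic g := by
  intro i j k l hij hjk hkl x y hx hxy
  have bij : ∀ n, Function.Bijective (HomologicalComplex.homologyMap g n) := fun n =>
    ConcreteCategory.bijective_of_isIso _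
  obtain ⟨z, rfl⟩ := exists_cycle hkl x hx
  have hz : K.homologyπ k z = 0 := by
    apply (bij k).1
    rw [homologyπ_map, map_zero]
    exact homologyπ_boundary y _ (by rw [i_map, hxy])
  obtain ⟨a, ha⟩ := exists_boundary hjk z hz
  obtain ⟨u, hu⟩ := exists_cycle hjk (y - g.f j a) (by
    rw [map_sub, ← hxy, ← ha, f_d, sub_self])
  obtain ⟨s, hs⟩ := (bij j).2 (L.homologyπ j u)
  obtain ⟨t, rfl⟩ := (ModuleCat.epi_iff_surjective (K.homologyπ j)).1 inferInstance s
  obtain ⟨b, hb⟩ := exists_boundary hij (u - HomologicalComplex.cyclesMap g j t) (by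
    rw [map_sub, ← hs, homologyπ_map, sub_self])
  refine ⟨a + K.iCycles j t, b, ?_, ?_⟩
  · rw [map_add, ha, d_i, add_zero]
  · rw [hb, map_sub, hu, i_map, map_add]
    abel

lemma quasiIso_of_coneAcyclic (g : K ⟶ L) (h : ConeAcyclic g) : QuasiIso g := by
  refine ⟨fun n => ?_⟩
  rw [quasiIsoAt_iff_isIso_homologyMap]
  apply (ConcreteCategory.isIso_iff_bijective _).2
  constructor
  · rw [injective_iff_map_eq_zero]
    intro s hs
    obtain ⟨t, rfl⟩ := (ModuleCat.epi_iff_surjective (K.homologyπ n)).1 inferInstance s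
    rw [homologyπ_map] at hs
    obtain ⟨w, hw⟩ := exists_boundary (i := n - 1) (by ring) _ hs
    rw [i_map] at hw
    obtain ⟨x', y', hx, -⟩ := h (n-2) (n-1) n (n+1) (by ring) (by ring) rfl (K.iCycles n t) w
      (d_i _ _ _) hw.symm
    exact homologyπ_boundary x' _ hx.symm
  · intro s
    obtain ⟨t, rfl⟩ := (ModuleCat.epi_iff_surjective (L.homologyπ n)).1 inferInstance s
    obtain ⟨x', y', hx, hy⟩ := h (n-1) n (n+1) (n+2) (by ring) (by ring) (by ring) 0
      (L.iCycles n t) (by simp) (by rw [d_i, map_zero])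
    obtain ⟨z, rfl⟩ := exists_cycle rfl x' hx.symm
    refine ⟨K.homologyπ n z, ?_⟩
    rw [homologyπ_map, eq_comm, ← sub_eq_zero, ← map_sub]
    apply homologyπ_boundary y'
    rw [map_sub, hy, i_map]
    abel
end homology

section total
variable (C C' : HomologicalComplex₂ (ModuleCat.{v} A) (ComplexShape.up ℤ) (ComplexShape.up ℤ))
    [C.HasTotal (ComplexShape.up ℤ)] [C'.HasTotal (ComplexShape.up ℤ)]

/-- The projection of the total complex on a summand. -/
noncomputable def prj (p q n : ℤ) : (C.total (ComplexShape.up ℤ)).X n ⟶ (C.X p).X q :=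
  C.totalDesc (fun p' q' _ => if h : p' = p ∧ q' = q then
    (C.XXIsoOfEq _ _ _ h.1 h.2).hom else 0)

/-- The inclusion of a summand. -/
noncomputable abbrev inj (p q n : ℤ) (h : p + q = n) :
    (C.X p).X q ⟶ (C.total (ComplexShape.up ℤ)).X n :=
  C.ιTotal (ComplexShape.up ℤ) p q n h

lemma inj_prj_self (p q n : ℤ) (h : p + q = n) : inj C p q n h ≫ prj C p q n = 𝟙 _ := by
  simp [inj, prj]

lemma inj_prj_ne (p q p' q' n : ℤ) (h : p + q = n) (hp : p ≠ p') :
    inj C p q n h ≫ prj C p' q' n = 0 := by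
  simp [inj, prj, hp]

lemma inj_d (p q n m : ℤ) (h : p + q = n) (hm : n + 1 = m) :
    inj C p q n h ≫ (C.total (ComplexShape.up ℤ)).d n m =
      (C.d p (p + 1)).f q ≫ inj C (p + 1) q m (by lia) +
      p.negOnePow • ((C.X p).d q (q + 1) ≫ inj C p (q + 1) m (by lia)) := by
  rw [HomologicalComplex₂.total_d, Preadditive.comp_add, HomologicalComplex₂.ι_D₁,
    HomologicalComplex₂.ι_D₂,
    C.d₁_eq (ComplexShape.up ℤ) (i₁' := p + 1) rfl q m (show p + 1 + q = m by lia),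
    C.d₂_eq (ComplexShape.up ℤ) p (i₂' := q + 1) rfl m (show p + (q + 1) = m by lia)]
  congr 1
  exact one_smul _ _

lemma d_prj (n m p' p q' q : ℤ) (hm : n + 1 = m) (h : p + q = m) (hp : p' + 1 = p)
    (hq : q' + 1 = q) :
    (C.total (ComplexShape.up ℤ)).d n m ≫ prj C p q m =
      prj C p' q n ≫ (C.d p' p).f q + p.negOnePow • (prj C p q' n ≫ (C.X p).d q' q) := by
  apply HomologicalComplex₂.total.hom_ext
  intro a b (hab : a + b = n)
  change inj C a b n hab ≫ _ = inj C a b n hab ≫ _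
  rw [← Category.assoc, inj_d C a b n m hab hm]
  simp only [Preadditive.add_comp, Preadditive.comp_add, Category.assoc, Linear.units_smul_comp,
    Linear.comp_units_smul]
  by_cases h1 : a = p'
  · subst h1 hp
    obtain rfl : b = q := by lia
    rw [inj_prj_self, inj_prj_ne _ _ _ _ _ _ _ (by lia), ← Category.assoc (inj C a b n hab),
      ← Category.assoc (inj C a b n hab), inj_prj_self, inj_prj_ne _ _ _ _ _ _ _ (by lia)]
    simp
  · by_cases h2 : a = p
    · subst h2 hq
      obtain rfl : b = q' := by lia
      rw [inj_prj_self, inj_prj_ne _ _ _ _ _ _ _ (by lia), ← Category.assoc (inj C a b n hab),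
        ← Category.assoc (inj C a b n hab), inj_prj_self, inj_prj_ne _ _ _ _ _ _ _ (by lia)]
      simp
    · rw [inj_prj_ne _ _ _ _ _ _ _ (by lia), inj_prj_ne _ _ _ _ _ _ _ (by lia),
        ← Category.assoc (inj C a b n hab),
        ← Category.assoc (inj C a b n hab), inj_prj_ne _ _ _ _ _ _ _ (by lia),
        inj_prj_ne _ _ _ _ _ _ _ (by lia)]
      simp

variable {C C'}

lemma map_prj (f : C ⟶ C') (p q n : ℤ) (h : p + q = n) :
    (HomologicalComplex₂.total.map f (ComplexShape.up ℤ)).f n ≫ prj C' p q n =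
      prj C p q n ≫ (f.f p).f q := by
  apply HomologicalComplex₂.total.hom_ext
  intro a b (hab : a + b = n)
  rw [HomologicalComplex₂.ιTotal_map_assoc]
  change _ ≫ inj C' a b n hab ≫ _ = inj C a b n hab ≫ _
  by_cases h1 : a = p
  · subst h1
    obtain rfl : b = q := by lia
    rw [inj_prj_self, ← Category.assoc, inj_prj_self]
    simp
  · rw [inj_prj_ne _ _ _ _ _ _ _ h1, ← Category.assoc, inj_prj_ne _ _ _ _ _ _ _ h1]
    simp

/-! Element versions. -/

lemma e_inj_self {p q n : ℤ} (h : p + q = n) (a : (C.X p).X q) :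
    prj C p q n (inj C p q n h a) = a :=
  ConcreteCategory.congr_hom (inj_prj_self C p q n h) a

lemma e_inj_ne {p q p' q' n : ℤ} (h : p + q = n) (hp : p ≠ p') (a : (C.X p).X q) :
    prj C p' q' n (inj C p q n h a) = 0 :=
  ConcreteCategory.congr_hom (inj_prj_ne C p q p' q' n h hp) a

lemma e_map_prj (f : C ⟶ C') (p q n : ℤ) (h : p + q = n) (x : (C.total (ComplexShape.up ℤ)).X n) :
    prj C' p q n ((HomologicalComplex₂.total.map f (ComplexShape.up ℤ)).f n x) =
      (f.f p).f q (prj C p q n x) :=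
  ConcreteCategory.congr_hom (map_prj f p q n h) x

lemma e_d_prj {n m p' p q' q : ℤ} (hm : n + 1 = m) (h : p + q = m) (hp : p' + 1 = p)
    (hq : q' + 1 = q) (x : (C.total (ComplexShape.up ℤ)).X n) (hx : prj C p' q n x = 0) :
    prj C p q m ((C.total (ComplexShape.up ℤ)).d n m x) =
      p.negOnePow • ((C.X p).d q' q (prj C p q' n x)) := by
  have := ConcreteCategory.congr_hom (d_prj C n m p' p q' q hm h hp hq) x
  refine this.trans ?_
  change (C.d p' p).f q (prj C p' q n x) + p.negOnePow • ((C.X p).d q' q (prj C p q' n x)) = _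
  rw [hx, map_zero, zero_add]

lemma span_top (n : ℤ) :
    Submodule.span A {x | ∃ (p q : ℤ) (h : p + q = n) (a : (C.X p).X q), inj C p q n h a = x} =
      (⊤ : Submodule A ((C.total (ComplexShape.up ℤ)).X n)) := by
  set S := Submodule.span A {x | ∃ (p q : ℤ) (h : p + q = n) (a : (C.X p).X q),
    inj C p q n h a = x}
  have : ModuleCat.ofHom S.mkQ = 0 := by
    apply HomologicalComplex₂.total.hom_ext
    intro p q h
    ext a
    have : inj C p q n h a ∈ S := Submodule.subset_span ⟨p, q, h, a, rfl⟩
    rw [comp_zero]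
    exact (Submodule.Quotient.mk_eq_zero S).2 this
  rw [eq_top_iff]
  intro x _
  exact (Submodule.Quotient.mk_eq_zero S).1 (ConcreteCategory.congr_hom this x)

lemma tot_induction {n : ℤ} {P : (C.total (ComplexShape.up ℤ)).X n → Prop}
    (hi : ∀ (p q : ℤ) (h : p + q = n) (a : (C.X p).X q), P (inj C p q n h a))
    (h0 : P 0) (ha : ∀ x y, P x → P y → P (x + y)) (hs : ∀ (r : A) x, P x → P (r • x)) (x) : P x := by
  have hx : x ∈ (⊤ : Submodule A ((C.total (ComplexShape.up ℤ)).X n)) := trivial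
  rw [← span_top n] at hx
  induction hx using Submodule.span_induction with
  | mem x hx => obtain ⟨p, q, h, a, rfl⟩ := hx; exact hi p q h a
  | zero => exact h0
  | add x y _ _ hx hy => exact ha x y hx hy
  | smul r x _ hx => exact hs r x hx

lemma bdd_below {n : ℤ} (x : (C.total (ComplexShape.up ℤ)).X n) :
    ∃ B : ℤ, ∀ p q, p ≤ B → prj C p q n x = 0 := by
  induction x using tot_induction with
  | hi p q h a => exact ⟨p - 1, fun p' q' hp => e_inj_ne h (by lia) a⟩
  | h0 => exact ⟨0, fun _ _ _ => map_zero _⟩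
  | ha x y hx hy =>
    obtain ⟨B, hB⟩ := hx
    obtain ⟨B', hB'⟩ := hy
    exact ⟨min B B', fun p q hp => by
      rw [map_add, hB p q (by lia), hB' p q (by lia), add_zero]⟩
  | hs r x hx =>
    obtain ⟨B, hB⟩ := hx
    exact ⟨B, fun p q hp => by rw [map_smul, hB p q hp, smul_zero]⟩

lemma eq_sum {n : ℤ} (x : (C.total (ComplexShape.up ℤ)).X n) :
    ∃ s : Finset ℤ, ∀ t, s ⊆ t →
      x = ∑ p ∈ t, inj C p (n - p) n (by lia) (prj C p (n - p) n x) := by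
  induction x using tot_induction with
  | hi p q h a =>
    refine ⟨{p}, fun t ht => ?_⟩
    obtain rfl : q = n - p := by lia
    rw [Finset.sum_eq_single p]
    · rw [e_inj_self]
    · intro b _ hb
      rw [e_inj_ne h hb.symm, map_zero]
    · intro hp
      exact absurd (ht (by simp)) hp
  | h0 => exact ⟨∅, fun t _ => by simp⟩
  | ha x y hx hy =>
    obtain ⟨s, hs⟩ := hx
    obtain ⟨s', hs'⟩ := hy
    refine ⟨s ∪ s', fun t ht => ?_⟩
    simp only [map_add, Finset.sum_add_distrib]
    rw [← hs t (Finset.union_subset_left ht), ← hs' t (Finset.union_subset_right ht)]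
  | hs r x hx =>
    obtain ⟨s, hs⟩ := hx
    refine ⟨s, fun t ht => ?_⟩
    simp only [map_smul, ← Finset.smul_sum]
    rw [← hs t ht]

lemma eq_zero_of_prj {n : ℤ} (x : (C.total (ComplexShape.up ℤ)).X n)
    (h : ∀ p q, p + q = n → prj C p q n x = 0) : x = 0 := by
  obtain ⟨s, hs⟩ := eq_sum x
  rw [hs s subset_rfl]
  exact Finset.sum_eq_zero fun p _ => by rw [h p (n - p) (by lia), map_zero]

lemma main_induction (f : C ⟶ C') (hcol : ∀ p, ConeAcyclic (f.f p))
    {i j k l : ℤ} (hij : i + 1 = j) (hjk : j + 1 = k) (hkl : k + 1 = l) (M : ℤ)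
    (hM : ∀ p q, p + q = k → M < p → IsZero ((C.X p).X q))
    (hM' : ∀ p q, p + q = j → M < p → IsZero ((C'.X p).X q)) (m : ℕ) :
    ∀ (x : (C.total (ComplexShape.up ℤ)).X k) (y : (C'.total (ComplexShape.up ℤ)).X j),
    (∀ p q, p + q = k → p + m ≤ M → prj C p q k x = 0) →
    (∀ p q, p + q = j → p + m ≤ M → prj C' p q j y = 0) →
    (C.total (ComplexShape.up ℤ)).d k l x = 0 →
    (HomologicalComplex₂.total.map f (ComplexShape.up ℤ)).f k x =
      (C'.total (ComplexShape.up ℤ)).d j k y →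
    ∃ (x' : (C.total (ComplexShape.up ℤ)).X j) (y' : (C'.total (ComplexShape.up ℤ)).X i),
      x = (C.total (ComplexShape.up ℤ)).d j k x' ∧
      y = (HomologicalComplex₂.total.map f (ComplexShape.up ℤ)).f j x' +
        (C'.total (ComplexShape.up ℤ)).d i j y' := by
  induction m with
  | zero =>
    intro x y hx hy _ _
    refine ⟨0, 0, ?_, ?_⟩
    · rw [map_zero]
      refine eq_zero_of_prj x fun p q hpq => ?_
      by_cases hp : p ≤ M
      · exact hx p q hpq (by simpa using hp)
      · have := ModuleCat.subsingleton_of_isZero (hM p q hpq (by lia))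
        exact Subsingleton.elim _ _
    · rw [map_zero, map_zero, add_zero]
      refine eq_zero_of_prj y fun p q hpq => ?_
      by_cases hp : p ≤ M
      · exact hy p q hpq (by simpa using hp)
      · have := ModuleCat.subsingleton_of_isZero (hM' p q hpq (by lia))
        exact Subsingleton.elim _ _
  | succ m ih =>
    intro x y hx hy hdx hxy
    obtain ⟨p, hp⟩ : ∃ p : ℤ, p + m = M := ⟨M - m, by ring⟩
    have hx0 : ∀ p' q, p' + q = k → p' < p → prj C p' q k x = 0 :=
      fun p' q e h => hx p' q e (by push_cast; lia)
    have hy0 : ∀ p' q, p' + q = j → p' < p → prj C' p' q j y = 0 :=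
      fun p' q e h => hy p' q e (by push_cast; lia)
    have h1 : (C.X p).d (k - p) (l - p) (prj C p (k - p) k x) = 0 := by
      have := e_d_prj (p' := p - 1) (p := p) (q' := k - p) (q := l - p) hkl (by ring) (by ring)
        (by lia) x (hx0 _ _ (by lia) (by lia))
      rw [hdx, map_zero, eq_comm, smul_eq_zero_iff_eq] at this
      exact this
    have h2 : (f.f p).f (k - p) (prj C p (k - p) k x) =
        (C'.X p).d (j - p) (k - p) (p.negOnePow • prj C' p (j - p) j y) := by
      rw [← e_map_prj f p (k - p) k (by ring), hxy,
        e_d_prj (p' := p - 1) (q' := j - p) hjk (by ring) (by ring) (by lia) y (hy0 _ _ (by lia) (by lia))]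
      simp only [Units.smul_def, map_zsmul]
    obtain ⟨a, b, ha, hb⟩ := hcol p (i - p) (j - p) (k - p) (l - p) (by lia) (by lia) (by lia)
      _ _ h1 h2
    have hjp : p + (j - p) = j := by ring
    have hip : p + (i - p) = i := by ring
    set X := inj C p (j - p) j hjp (p.negOnePow • a) with hX
    set Y := inj C' p (i - p) i hip b with hY
    have key := ih (x - (C.total (ComplexShape.up ℤ)).d j k X)
      (y - ((HomologicalComplex₂.total.map f (ComplexShape.up ℤ)).f j X +
        (C'.total (ComplexShape.up ℤ)).d i j Y))
    have key2 := key ?_ ?_ ?_ ?_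
    rotate_left
    · intro p' q' e hp'
      have hne : prj C (p' - 1) q' j X = 0 := e_inj_ne _ (by lia) _
      rw [map_sub, e_d_prj (p' := p' - 1) (q' := q' - 1) hjk e (by ring) (by ring) X hne]
      by_cases h : p' = p
      · subst h
        obtain rfl : q' = k - p' := by lia
        obtain hq : k - p' - 1 = j - p' := by lia
        rw [hq, hX, e_inj_self, ha]
        simp only [Units.smul_def, map_zsmul]
        simp only [← Units.smul_def, smul_smul, Int.units_mul_self, one_smul, sub_self]
      · rw [hx0 p' q' e (by lia), hX, e_inj_ne _ (Ne.symm h), map_zero, smul_zero, sub_zero]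
    · intro p' q' e hp'
      have hne : prj C' (p' - 1) q' i Y = 0 := e_inj_ne _ (by lia) _
      rw [map_sub, map_add, e_map_prj f p' q' j e,
        e_d_prj (p' := p' - 1) (q' := q' - 1) hij e (by ring) (by ring) Y hne]
      by_cases h : p' = p
      · subst h
        obtain rfl : q' = j - p' := by lia
        obtain hq : j - p' - 1 = i - p' := by lia
        rw [hq, hX, hY, e_inj_self, e_inj_self]
        have hb' : prj C' p' (j - p') j y = p'.negOnePow • ((f.f p').f (j - p') a +
            (C'.X p').d (i - p') (j - p') b) := by
          rw [← hb, smul_smul, Int.units_mul_self, one_smul]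
        rw [hb', smul_add]
        simp only [Units.smul_def, map_zsmul, sub_self]
      · rw [hy0 p' q' e (by lia), hX, hY, e_inj_ne _ (Ne.symm h), e_inj_ne _ (Ne.symm h),
          map_zero, map_zero, smul_zero, add_zero, sub_zero]
    · rw [map_sub, hdx, d_d, sub_zero]
    · rw [map_sub, map_sub, map_add, d_d, add_zero, hxy, f_d]
    obtain ⟨x', y', hx', hy'⟩ := key2
    refine ⟨x' + X, y' + Y, ?_, ?_⟩
    · rw [map_add, ← hx']
      abel
    · rw [map_add, map_add, ← sub_eq_zero]
      rw [← sub_eq_zero] at hy'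
      rw [← hy']
      abel

end total
end TotQI

theorem total_map_quasiIso_of_columns_quasiIso
    (A : Type) [Ring A]
    (C C' : HomologicalComplex₂ (ModuleCat A) (ComplexShape.up ℤ) (ComplexShape.up ℤ))
    [C.HasTotal (ComplexShape.up ℤ)] [C'.HasTotal (ComplexShape.up ℤ)]
    (f : C ⟶ C')
    (hbound :
      ((∃ N : ℤ, ∀ p q : ℤ, N < p → IsZero ((C.X p).X q)) ∧
       (∃ N : ℤ, ∀ p q : ℤ, N < p → IsZero ((C'.X p).X q))) ∨
      ((∃ N : ℤ, ∀ p q : ℤ, q < N → IsZero ((C.X p).X q)) ∧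
       (∃ N : ℤ, ∀ p q : ℤ, q < N → IsZero ((C'.X p).X q))))
    (hcol : ∀ p : ℤ, QuasiIso (f.f p)) :
    QuasiIso (HomologicalComplex₂.total.map f (ComplexShape.up ℤ)) := by
  apply TotQI.quasiIso_of_coneAcyclic
  intro i j k l hij hjk hkl x y hx hxy
  obtain ⟨M, hM, hM'⟩ : ∃ M : ℤ, (∀ p q, p + q = k → M < p → IsZero ((C.X p).X q)) ∧
      (∀ p q, p + q = j → M < p → IsZero ((C'.X p).X q)) := by
    rcases hbound with ⟨⟨N, hN⟩, ⟨N', hN'⟩⟩ | ⟨⟨N, hN⟩, ⟨N', hN'⟩⟩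
    · exact ⟨max N N', fun p q _ h => hN p q (by lia), fun p q _ h => hN' p q (by lia)⟩
    · exact ⟨max (k - N) (j - N'), fun p q _ h => hN p q (by lia),
        fun p q _ h => hN' p q (by lia)⟩
  obtain ⟨B, hB⟩ := TotQI.bdd_below x
  obtain ⟨B', hB'⟩ := TotQI.bdd_below y
  exact TotQI.main_induction f (fun p => TotQI.coneAcyclic_of_quasiIso (f.f p)) hij hjk hkl M hM hM'
    (M - min B B').toNat x y (fun p q _ h => hB p q (by lia)) (fun p q _ h => hB' p q (by lia))
    hx hxy
end

section
/- Let A be a commutative ring and let C, D be bounded-below cochain complexes of flat A-modules (C^i = 0 = D^i for all sufficiently negative i). Assume H^i(C) = 0 = H^i(D) for all i ≠ 0 and H^0(C) ≅ A ≅ H^0(D) as A-modules. Then the tensor product complex C ⊗_A D satisfies H^i(C ⊗_A D) = 0 for all i ≠ 0 and H^0(C ⊗_A D) ≅ A. -/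
/-!
STATEMENT 6: Let `A` be a commutative ring and `C`, `D` bounded-below cochain complexes
of flat `A`-modules. Assume `H^i(C) = 0 = H^i(D)` for all `i ≠ 0` and
`H^0(C) ≅ A ≅ H^0(D)` as `A`-modules. Then the tensor product complex `C ⊗_A D`
(with `(C ⊗ D)^n = ⊕_{i+j=n} C^i ⊗_A D^j` and the Koszul sign differential,
here `HomologicalComplex.tensorObj C D`) satisfies `H^i(C ⊗_A D) = 0` for `i ≠ 0`
and `H^0(C ⊗_A D) ≅ A`.
-/

open CategoryTheory Limits MonoidalCategory

variable {A : Type} [CommRing A]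

instance : (curriedTensor (ModuleCat A)).Additive where
  map_add := by intros; ext; simp [curriedTensor]

instance (X : ModuleCat A) : ((curriedTensor (ModuleCat A)).obj X).Additive :=
  inferInstanceAs (tensorLeft X).Additive

namespace TensorRes
open scoped TensorProduct

variable (C D : CochainComplex (ModuleCat A) ℤ)

/-- inclusion of a summand -/
noncomputable def J (p q n : ℤ) (h : p + q = n) :
    (C.X p ⊗[A] D.X q) →ₗ[A] ((HomologicalComplex.tensorObj C D).X n) :=
  (HomologicalComplex.ιTensorObj C D p q n h).hom

lemma d_J (p q n p' q' n' : ℤ) (h : p + q = n) (hp : p + 1 = p') (hq : q + 1 = q')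
    (hn : n + 1 = n') (x : C.X p ⊗[A] D.X q) :
    ((HomologicalComplex.tensorObj C D).d n n').hom (J C D p q n h x) =
      J C D p' q n' (by omega) ((C.d p p').hom.rTensor (D.X q) x) +
      p.negOnePow • J C D p q' n' (by omega) ((D.d q q').hom.lTensor (C.X p) x) := by
  have e : HomologicalComplex.ιTensorObj C D p q n h ≫ (HomologicalComplex.tensorObj C D).d n n'
    = (C.d p p' ▷ D.X q) ≫ HomologicalComplex.ιTensorObj C D p' q n' (by omega) +
      p.negOnePow • ((C.X p ◁ D.d q q') ≫ HomologicalComplex.ιTensorObj C D p q' n' (by omega)) := by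
    rw [HomologicalComplex.mapBifunctor.d_eq, Preadditive.comp_add,
      HomologicalComplex.mapBifunctor.ι_D₁, HomologicalComplex.mapBifunctor.ι_D₂,
      HomologicalComplex.mapBifunctor.d₁_eq _ _ _ _ (i₁' := p') (by simpa using hp) _ _ (by simp; omega),
      HomologicalComplex.mapBifunctor.d₂_eq _ _ _ _ _ (i₂' := q') (by simpa using hq) _ (by simp; omega)]
    simp
  have := congrArg (fun f => f.hom x) e
  exact this

open Classical in
/-- projection to a summand -/
noncomputable def P (p q n : ℤ) :
    ((HomologicalComplex.tensorObj C D).X n) →ₗ[A] (C.X p ⊗[A] D.X q) :=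
  (HomologicalComplex.mapBifunctorDesc (K₁ := C) (K₂ := D) (F := curriedTensor (ModuleCat A))
    (c := ComplexShape.up ℤ) (j := n) (A := C.X p ⊗ D.X q)
    (fun i j _ => if h : i = p ∧ j = q then eqToHom (by rw [h.1, h.2]; rfl) else 0)).hom

lemma P_J (p q n : ℤ) (h : p + q = n) (x : C.X p ⊗[A] D.X q) :
    P C D p q n (J C D p q n h x) = x := by
  have := congrArg (fun f => f.hom x) (HomologicalComplex.ι_mapBifunctorDesc (K₁ := C) (K₂ := D)
    (F := curriedTensor (ModuleCat A))
    (c := ComplexShape.up ℤ) (j := n) (A := C.X p ⊗ D.X q)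
    (fun i j _ => if h : i = p ∧ j = q then eqToHom (by rw [h.1, h.2]; rfl) else 0) p q h)
  refine Eq.trans this ?_
  simp

lemma P_J' (p q n p' q' : ℤ) (h : p' + q' = n) (hp : p' ≠ p) (x : C.X p' ⊗[A] D.X q') :
    P C D p q n (J C D p' q' n h x) = 0 := by
  have := congrArg (fun f => f.hom x) (HomologicalComplex.ι_mapBifunctorDesc (K₁ := C) (K₂ := D)
    (F := curriedTensor (ModuleCat A))
    (c := ComplexShape.up ℤ) (j := n) (A := C.X p ⊗ D.X q)
    (fun i j _ => if h : i = p ∧ j = q then eqToHom (by rw [h.1, h.2]; rfl) else 0) p' q' h)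
  refine Eq.trans this ?_
  simp [hp]

/-- filtration -/
noncomputable def F (k n : ℤ) : Submodule A ((HomologicalComplex.tensorObj C D).X n) :=
  Submodule.span A {t | ∃ (p q : ℤ) (h : p + q = n) (_ : k ≤ p) (x : C.X p ⊗[A] D.X q),
    J C D p q n h x = t}

lemma F_top (a n : ℤ) (hC : ∀ i < a, IsZero (C.X i)) : F C D a n = ⊤ := by
  have key : ModuleCat.ofHom (F C D a n).mkQ = 0 := by
    apply HomologicalComplex.mapBifunctor.hom_ext
    intro p q h
    ext x
    change (F C D a n).mkQ (J C D p q n h x) = 0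
    rw [Submodule.mkQ_apply, Submodule.Quotient.mk_eq_zero]
    by_cases hp : a ≤ p
    · exact Submodule.subset_span ⟨p, q, h, hp, x, rfl⟩
    · have := ModuleCat.subsingleton_of_isZero (hC p (by omega))
      have : x = 0 := Subsingleton.elim (α := C.X p ⊗[A] D.X q) _ _
      rw [this, map_zero]
      exact zero_mem _
  have := congrArg (fun f => f.hom) key
  simp at this
  have h2 := (F C D a n).ker_mkQ
  rw [this] at h2
  rw [← h2]; simp

lemma F_bot (b n k : ℤ) (hD : ∀ i < b, IsZero (D.X i)) (hk : n - b < k) : F C D k n = ⊥ := by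
  rw [F, Submodule.span_eq_bot]
  rintro t ⟨p, q, h, hp, x, rfl⟩
  have := ModuleCat.subsingleton_of_isZero (hD q (by omega))
  have : x = 0 := Subsingleton.elim (α := C.X p ⊗[A] D.X q) _ _
  rw [this, map_zero]

lemma F_anti (k k' n : ℤ) (h : k ≤ k') : F C D k' n ≤ F C D k n := by
  apply Submodule.span_mono
  rintro t ⟨p, q, h, hp, x, rfl⟩
  exact ⟨p, q, h, by omega, x, rfl⟩

lemma J_mem (k p q n : ℤ) (h : p + q = n) (hp : k ≤ p) (x : C.X p ⊗[A] D.X q) :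
    J C D p q n h x ∈ F C D k n := Submodule.subset_span ⟨p, q, h, hp, x, rfl⟩

lemma F_split (k q n : ℤ) (h : k + q = n) (z) (hz : z ∈ F C D k n) :
    ∃ x z', z' ∈ F C D (k + 1) n ∧ z = J C D k q n h x + z' := by
  induction hz using Submodule.span_induction with
  | mem t ht =>
    obtain ⟨p, q', h', hp, x, rfl⟩ := ht
    by_cases hpk : p = k
    · subst hpk
      obtain rfl : q = q' := by omega
      exact ⟨x, 0, zero_mem _, by simp⟩
    · exact ⟨0, _, J_mem C D _ p q' n h' (by omega) x, by simp⟩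
  | zero => exact ⟨0, 0, zero_mem _, by simp⟩
  | add t t' _ _ h1 h2 =>
    obtain ⟨x, z, hz, rfl⟩ := h1
    obtain ⟨x', z', hz', rfl⟩ := h2
    exact ⟨x + x', z + z', add_mem hz hz', by rw [map_add]; abel⟩
  | smul r t _ h1 =>
    obtain ⟨x, z, hz, rfl⟩ := h1
    exact ⟨r • x, r • z, Submodule.smul_mem _ _ hz, by rw [map_smul, smul_add]⟩

lemma P_zero (k q n : ℤ) (z) (hz : z ∈ F C D (k + 1) n) : P C D k q n z = 0 := by
  induction hz using Submodule.span_induction with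
  | mem t ht =>
    obtain ⟨p, q', h', hp, x, rfl⟩ := ht
    exact P_J' C D _ _ _ _ _ _ (by omega) _
  | zero => simp
  | add t t' _ _ h1 h2 => rw [map_add, h1, h2, add_zero]
  | smul r t _ h1 => rw [map_smul, h1, smul_zero]

lemma d_F (k n n' : ℤ) (hn : n + 1 = n') (z) (hz : z ∈ F C D k n) :
    ((HomologicalComplex.tensorObj C D).d n n').hom z ∈ F C D k n' := by
  induction hz using Submodule.span_induction with
  | mem t ht =>
    obtain ⟨p, q', h', hp, x, rfl⟩ := ht
    rw [d_J C D p q' n _ _ n' h' rfl rfl hn]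
    refine add_mem (J_mem _ _ _ _ _ _ _ (by omega) _) ?_
    rcases Int.units_eq_one_or p.negOnePow with h | h <;> rw [h]
    · rw [one_smul]; exact J_mem _ _ _ _ _ _ _ (by omega) _
    · rw [Units.neg_smul, one_smul]; exact neg_mem (J_mem _ _ _ _ _ _ _ (by omega) _)
  | zero => simp
  | add t t' _ _ h1 h2 => rw [map_add]; exact add_mem h1 h2
  | smul r t _ h1 => rw [map_smul]; exact Submodule.smul_mem _ _ h1

section Lin
variable {M X Y Z W : Type} [AddCommGroup M] [Module A M] [AddCommGroup X] [Module A X]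
  [AddCommGroup Y] [Module A Y] [AddCommGroup Z] [Module A Z] [AddCommGroup W] [Module A W]

lemma lin_aux (t : M ⊗[A] (A × Y)) : ∃ (m : M) (w : M ⊗[A] Y),
    t = m ⊗ₜ (1, 0) + (LinearMap.inr A A Y).lTensor M w := by
  induction t using TensorProduct.induction_on with
  | zero => exact ⟨0, 0, by simp⟩
  | tmul m y =>
    refine ⟨y.1 • m, m ⊗ₜ y.2, ?_⟩
    rw [LinearMap.lTensor_tmul, TensorProduct.smul_tmul, ← TensorProduct.tmul_add]
    simp
  | add x y hx hy =>
    obtain ⟨m, w, rfl⟩ := hx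
    obtain ⟨m', w', rfl⟩ := hy
    exact ⟨m + m', w + w', by rw [TensorProduct.add_tmul, map_add]; abel⟩

lemma lin1 [Module.Flat A M] (e : Y →ₗ[A] Z) (g : Z →ₗ[A] W) (u : Z)
    (hu : ∀ z, g z = 0 → ∃ (a : A) (y : Y), z = a • u + e y) (hgu : g u = 0)
    (hge : ∀ y, g (e y) = 0)
    (z : M ⊗[A] Z) (hz : g.lTensor M z = 0) : ∃ (m : M) (w : M ⊗[A] Y),
      z = m ⊗ₜ u + e.lTensor M w := by
  let f : A × Y →ₗ[A] Z := (LinearMap.toSpanSingleton A Z u).coprod e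
  have hex : Function.Exact f g := by
    intro z
    constructor
    · intro h
      obtain ⟨a, y, rfl⟩ := hu z h
      exact ⟨(a, y), by simp [f]⟩
    · rintro ⟨⟨a, y⟩, rfl⟩
      simp [f, hgu, hge]
  obtain ⟨t, rfl⟩ := (Module.Flat.lTensor_exact M hex z).1 hz
  obtain ⟨m, w, rfl⟩ := lin_aux t
  refine ⟨m, w, ?_⟩
  rw [map_add, ← LinearMap.lTensor_comp_apply]
  simp [f]

lemma lin2 [Module.Flat A M] (e' : X →ₗ[A] Y) (e : Y →ₗ[A] Z) (u : Z)
    (hu : ∀ (a : A) (y : Y), a • u = e y → a = 0) (hee : Function.Exact e' e)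
    (m : M) (w : M ⊗[A] Y) (h : m ⊗ₜ u = e.lTensor M w) : m = 0 := by
  let f : A × Y →ₗ[A] Z := (LinearMap.toSpanSingleton A Z u).coprod e
  have hex : Function.Exact (LinearMap.inr A A Y ∘ₗ e') f := by
    rintro ⟨a, y⟩
    constructor
    · intro h
      simp only [f, LinearMap.coprod_apply, LinearMap.toSpanSingleton_apply] at h
      obtain rfl := hu a (-y) (by rw [map_neg]; exact eq_neg_of_add_eq_zero_left h)
      obtain ⟨x, rfl⟩ := (hee y).1 (by simpa using h)
      exact ⟨x, by simp⟩
    · rintro ⟨x, hx⟩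
      rw [← hx]
      simp [f, hee.apply_apply_eq_zero]
  have h0 : f.lTensor M (m ⊗ₜ (1, 0) - (LinearMap.inr A A Y).lTensor M w) = 0 := by
    rw [map_sub, ← LinearMap.lTensor_comp_apply]
    simp [f, h]
  obtain ⟨t, ht⟩ := (Module.Flat.lTensor_exact M hex _).1 h0
  have h3 := congrArg ((LinearMap.fst A A Y).lTensor M) ht
  rw [map_sub, ← LinearMap.lTensor_comp_apply, ← LinearMap.lTensor_comp_apply,
    ← LinearMap.comp_assoc] at h3
  simp only [LinearMap.fst_comp_inr, LinearMap.zero_comp, LinearMap.lTensor_zero,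
    LinearMap.zero_apply, LinearMap.lTensor_tmul, LinearMap.fst_apply, sub_zero] at h3
  have := congrArg (TensorProduct.rid A M) h3
  simpa using this.symm
end Lin

lemma isZero_iff (K : CochainComplex (ModuleCat A) ℤ) (i j k : ℤ) (hi : i + 1 = j)
    (hk : j + 1 = k) : IsZero (K.homology j) ↔ Function.Exact (K.d i j).hom (K.d j k).hom := by
  rw [← HomologicalComplex.exactAt_iff_isZero_homology,
    K.exactAt_iff' i j k (by simp; omega) (by simp; omega), ShortComplex.moduleCat_exact_iff]
  constructor
  · intro h x
    constructor
    · intro hx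
      exact h x hx
    · rintro ⟨y, rfl⟩
      exact (K.sc' i j k).moduleCat_zero_apply y
  · intro h x hx
    exact (h x).1 hx

/-- `u` is a cocycle whose class freely generates the homology. -/
def Gen (K : CochainComplex (ModuleCat A) ℤ) (i j k : ℤ) (u : K.X j) : Prop :=
  (K.d j k).hom u = 0 ∧
  (∀ z, (K.d j k).hom z = 0 → ∃ (a : A) (y : K.X i), z = a • u + (K.d i j).hom y) ∧
  (∀ (a : A) (y : K.X i), a • u = (K.d i j).hom y → a = 0)

lemma gen_iff (K : CochainComplex (ModuleCat A) ℤ) (i j k : ℤ) (hi : i + 1 = j)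
    (hk : j + 1 = k) : Nonempty (K.homology j ≃ₗ[A] A) ↔ ∃ u, Gen K i j k u := by
  let S := K.sc' i j k
  let e : K.homology j ≃ₗ[A] (LinearMap.ker S.g.hom ⧸ LinearMap.range S.moduleCatToCycles) :=
    (K.homologyIsoSc' i j k (by simp; omega) (by simp; omega) ≪≫
      S.moduleCatHomologyIso).toLinearEquiv
  constructor
  · rintro ⟨f⟩
    let f' := f.symm.trans e
    obtain ⟨⟨(u : K.X j), hu⟩, hu'⟩ := Submodule.mkQ_surjective _ (f' 1)
    rw [Submodule.mkQ_apply] at hu'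
    refine ⟨u, hu, ?_, ?_⟩
    · intro z hz
      let z' : LinearMap.ker S.g.hom := ⟨z, hz⟩
      obtain ⟨a, ha⟩ := f'.surjective (Submodule.Quotient.mk z')
      have h1 : f' a = Submodule.Quotient.mk (a • ⟨u, hu⟩) := by
        rw [Submodule.Quotient.mk_smul, hu', ← map_smul]; simp
      rw [h1] at ha
      rw [eq_comm, Submodule.Quotient.eq] at ha
      obtain ⟨y, hy⟩ := ha
      refine ⟨a, y, ?_⟩
      have := congrArg Subtype.val hy
      have h3 : (K.d i j).hom y = (z : K.X j) - a • (u : K.X j) := this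
      rw [h3]; abel
    · intro a y h
      have h1 : f' a = Submodule.Quotient.mk (a • ⟨u, hu⟩) := by
        rw [Submodule.Quotient.mk_smul, hu', ← map_smul]; simp
      have h2 : f' a = 0 := by
        rw [h1, Submodule.Quotient.mk_eq_zero]
        exact ⟨y, Subtype.ext h.symm⟩
      exact (LinearEquiv.map_eq_zero_iff f').1 h2
  · rintro ⟨u, hu, hs, hin⟩
    let u' : LinearMap.ker S.g.hom := ⟨u, hu⟩
    let g : A →ₗ[A] (LinearMap.ker S.g.hom ⧸ LinearMap.range S.moduleCatToCycles) :=
      LinearMap.toSpanSingleton A _ (Submodule.Quotient.mk u')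
    have hg : Function.Bijective g := by
      constructor
      · rw [injective_iff_map_eq_zero]
        intro a ha
        rw [LinearMap.toSpanSingleton_apply, ← Submodule.Quotient.mk_smul,
          Submodule.Quotient.mk_eq_zero] at ha
        obtain ⟨y, hy⟩ := ha
        exact hin a y (congrArg Subtype.val hy).symm
      · intro x
        obtain ⟨⟨(z : K.X j), hz⟩, rfl⟩ := Submodule.mkQ_surjective _ x
        obtain ⟨a, y, hy⟩ := hs z hz
        refine ⟨a, ?_⟩
        rw [Submodule.mkQ_apply, LinearMap.toSpanSingleton_apply, ← Submodule.Quotient.mk_smul,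
          eq_comm, Submodule.Quotient.eq]
        refine ⟨y, Subtype.ext ?_⟩
        change (K.d i j).hom y = z - a • u
        rw [hy]; abel
    exact ⟨e.trans (LinearEquiv.ofBijective g hg).symm⟩

/-- the comparison map -/
noncomputable def phi (u : D.X 0) (n : ℤ) :
    C.X n →ₗ[A] ((HomologicalComplex.tensorObj C D).X n) :=
  J C D n 0 n (add_zero n) ∘ₗ (TensorProduct.mk A (C.X n) (D.X 0)).flip u

lemma phi_apply (u : D.X 0) (n : ℤ) (c) :
    phi C D u n c = J C D n 0 n (add_zero n) (c ⊗ₜ u) := rfl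

lemma d_phi (u : D.X 0) (hu : (D.d 0 1).hom u = 0) (n n' : ℤ) (h : n + 1 = n') (c) :
    ((HomologicalComplex.tensorObj C D).d n n').hom (phi C D u n c) =
      phi C D u n' ((C.d n n').hom c) := by
  rw [phi_apply, d_J C D n 0 n n' 1 n' (add_zero n) h (by simp) h]
  rw [LinearMap.rTensor_tmul, LinearMap.lTensor_tmul, hu, TensorProduct.tmul_zero, map_zero,
    smul_zero, add_zero, phi_apply]

/-- One step of the filtration argument. -/
lemma step (hCflat : ∀ i : ℤ, Module.Flat A (C.X i))
    (hD : ∀ i : ℤ, i ≠ 0 → IsZero (D.homology i)) (u : D.X 0) (hu : Gen D (-1) 0 1 u)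
    (m n l : ℤ) (hm : m + 1 = n) (hl : n + 1 = l) (k : ℤ) (c : C.X l) (z)
    (hz : z ∈ F C D k n)
    (hd : ((HomologicalComplex.tensorObj C D).d n l).hom z = phi C D u l c) :
    ∃ c' w, z - phi C D u n c' - ((HomologicalComplex.tensorObj C D).d m n).hom w ∈
      F C D (k + 1) n := by
  obtain ⟨q, hq⟩ : ∃ q, k + q = n := ⟨n - k, by omega⟩
  obtain ⟨q', hq'⟩ : ∃ q', q' + 1 = q := ⟨q - 1, by omega⟩
  obtain ⟨x, z', hz', rfl⟩ := F_split C D k q n hq z hz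
  have hflat := hCflat k
  -- reduction
  have red : ∀ w : C.X k ⊗[A] D.X q', ∀ c' : C.X n,
      J C D k q n hq x - phi C D u n c' = J C D k q n hq ((D.d q' q).hom.lTensor _ w) →
      ∃ c' w, J C D k q n hq x + z' - phi C D u n c' -
        ((HomologicalComplex.tensorObj C D).d m n).hom w ∈ F C D (k + 1) n := by
    intro w c' h
    refine ⟨c', k.negOnePow • J C D k q' m (by omega) w, ?_⟩
    have e : ((HomologicalComplex.tensorObj C D).d m n).hom
        (k.negOnePow • J C D k q' m (by omega) w) =
        k.negOnePow • J C D (k + 1) q' n (by omega) ((C.d k (k + 1)).hom.rTensor (D.X q') w) +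
        J C D k q n hq ((D.d q' q).hom.lTensor _ w) := by
      have e0 := d_J C D k q' m (k + 1) q n (by omega) rfl hq' hm w
      rcases Int.units_eq_one_or k.negOnePow with h | h <;> rw [h] at e0 ⊢
      · rw [one_smul, e0, one_smul, one_smul]
      · rw [Units.neg_smul, one_smul, map_neg, e0, Units.neg_smul, one_smul, Units.neg_smul,
          one_smul]; abel
    have e2 : J C D k q n hq x + z' - phi C D u n c' -
        ((HomologicalComplex.tensorObj C D).d m n).hom (k.negOnePow • J C D k q' m (by omega) w) =
        z' - k.negOnePow • J C D (k + 1) q' n (by omega)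
          ((C.d k (k + 1)).hom.rTensor (D.X q') w) := by
      rw [e, ← h]; abel
    rw [e2]
    refine sub_mem hz' ?_
    rcases Int.units_eq_one_or k.negOnePow with h | h <;> rw [h]
    · rw [one_smul]; exact J_mem _ _ _ _ _ _ _ (by omega) _
    · rw [Units.neg_smul, one_smul]; exact neg_mem (J_mem _ _ _ _ _ _ _ (by omega) _)
  -- the component of the equation
  have hP : k.negOnePow • (D.d q (q + 1)).hom.lTensor (C.X k) x =
      P C D k (q + 1) l (phi C D u l c) := by
    rw [← hd, map_add, map_add, P_zero C D k (q + 1) l _ (d_F C D _ n l hl z' hz'),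
      d_J C D k q n (k + 1) (q + 1) l hq rfl rfl hl, map_add,
      P_J' C D _ _ _ _ _ _ (by omega), zero_add, add_zero]
    rcases Int.units_eq_one_or k.negOnePow with h | h <;> rw [h]
    · rw [one_smul, one_smul, P_J]
    · rw [Units.neg_smul, one_smul, Units.neg_smul, one_smul, map_neg, P_J]
  -- the component is a cocycle
  have hcoc : (D.d q (q + 1)).hom.lTensor (C.X k) x = 0 := by
    by_cases hkl : k = l
    · subst hkl
      obtain rfl : q = -1 := by omega
      have h1 : (((k.negOnePow : ℤˣ) : ℤ) • c) ⊗ₜ[A] u = (D.d (-1) 0).hom.lTensor (C.X k) x := by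
        have h2 : k.negOnePow • (D.d (-1) 0).hom.lTensor (C.X k) x = c ⊗ₜ[A] u := by
          refine Eq.trans hP ?_
          exact P_J C D k 0 k _ _
        rw [← TensorProduct.smul_tmul', ← h2]
        rcases Int.units_eq_one_or k.negOnePow with h | h <;> rw [h] <;> simp
      have h0 := lin2 (D.d (-2) (-1)).hom (D.d (-1) 0).hom u hu.2.2
        ((isZero_iff D (-2) (-1) 0 (by norm_num) (by norm_num)).1 (hD (-1) (by norm_num)))
        _ x h1
      rw [h0, TensorProduct.zero_tmul] at h1
      exact h1.symm
    · rw [phi_apply, P_J' C D _ _ _ _ _ _ (Ne.symm hkl)] at hP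
      exact (smul_eq_zero_iff_eq _).1 hP
  by_cases hkn : q = 0
  · subst hkn
    obtain rfl : k = n := by omega
    obtain rfl : q' = -1 := by omega
    obtain ⟨c', w, hx⟩ := lin1 (D.d (-1) 0).hom (D.d 0 1).hom u hu.2.1 hu.1
      (fun y => by rw [← LinearMap.comp_apply, ← ModuleCat.hom_comp, D.d_comp_d]; rfl) x hcoc
    refine red w c' ?_
    rw [hx, phi_apply, map_add]; abel
  · have hex := (isZero_iff D q' q (q + 1) hq' rfl).1 (hD q hkn)
    obtain ⟨w, hw⟩ := (Module.Flat.lTensor_exact (C.X k) hex x).1 hcoc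
    refine red w 0 ?_
    rw [hw, map_zero, sub_zero]

lemma main (hCflat : ∀ i : ℤ, Module.Flat A (C.X i))
    (hCbdd : ∃ N : ℤ, ∀ i : ℤ, i < N → IsZero (C.X i))
    (hDbdd : ∃ N : ℤ, ∀ i : ℤ, i < N → IsZero (D.X i))
    (hD : ∀ i : ℤ, i ≠ 0 → IsZero (D.homology i)) (u : D.X 0) (hu : Gen D (-1) 0 1 u)
    (m n l : ℤ) (hm : m + 1 = n) (hl : n + 1 = l) (c : C.X l) (z)
    (hd : ((HomologicalComplex.tensorObj C D).d n l).hom z = phi C D u l c) :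
    ∃ c' w, z = phi C D u n c' + ((HomologicalComplex.tensorObj C D).d m n).hom w ∧
      (C.d n l).hom c' = c := by
  obtain ⟨a, ha⟩ := hCbdd
  obtain ⟨b, hb⟩ := hDbdd
  have inj : ∀ c : C.X l, phi C D u l c = 0 → c = 0 := by
    intro c hc
    have := hCflat l
    have h1 := congrArg (P C D l 0 l) hc
    rw [phi_apply, P_J, map_zero] at h1
    exact lin2 (D.d (-2) (-1)).hom (D.d (-1) 0).hom u hu.2.2
        ((isZero_iff D (-2) (-1) 0 (by norm_num) (by norm_num)).1 (hD (-1) (by norm_num)))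
        c 0 (by rw [h1, map_zero])
  have dd : ∀ w, ((HomologicalComplex.tensorObj C D).d n l).hom
      (((HomologicalComplex.tensorObj C D).d m n).hom w) = 0 := fun w => by
    rw [← LinearMap.comp_apply, ← ModuleCat.hom_comp, HomologicalComplex.d_comp_d]; rfl
  have key : ∀ (j : ℕ) (k : ℤ), n - b < k + j → ∀ (c : C.X l) (z), z ∈ F C D k n →
      ((HomologicalComplex.tensorObj C D).d n l).hom z = phi C D u l c →
      ∃ c' w, z = phi C D u n c' + ((HomologicalComplex.tensorObj C D).d m n).hom w ∧
        (C.d n l).hom c' = c := by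
    intro j
    induction j with
    | zero =>
      intro k hk c z hz hd
      rw [F_bot C D b n k hb (by simpa using hk), Submodule.mem_bot] at hz
      subst hz
      rw [map_zero] at hd
      refine ⟨0, 0, by simp, ?_⟩
      rw [inj c hd.symm, map_zero]
    | succ j ih =>
      intro k hk c z hz hd
      obtain ⟨c₁, w₁, h₁⟩ := step C D hCflat hD u hu m n l hm hl k c z hz hd
      obtain ⟨c₂, w₂, h₂, h₃⟩ := ih (k + 1) (by push_cast at hk; omega) (c - (C.d n l).hom c₁) _ h₁
        (by rw [map_sub, map_sub, dd, hd, d_phi C D u hu.1 n l hl, map_sub, sub_zero])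
      refine ⟨c₁ + c₂, w₁ + w₂, ?_, by rw [map_add, h₃]; abel⟩
      rw [map_add, map_add]
      have : z = phi C D u n c₁ + ((HomologicalComplex.tensorObj C D).d m n).hom w₁ +
        (z - phi C D u n c₁ - ((HomologicalComplex.tensorObj C D).d m n).hom w₁) := by abel
      rw [this, h₂]; abel
  exact key (n - b + 1 - a).toNat a (by omega) c z (by rw [F_top C D a n ha]; trivial) hd

end TensorRes

theorem tensor_cohomology_of_resolutions
    (C D : CochainComplex (ModuleCat A) ℤ)
    (hCflat : ∀ i : ℤ, Module.Flat A (C.X i)) (hDflat : ∀ i : ℤ, Module.Flat A (D.X i))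
    (hCbdd : ∃ N : ℤ, ∀ i : ℤ, i < N → IsZero (C.X i))
    (hDbdd : ∃ N : ℤ, ∀ i : ℤ, i < N → IsZero (D.X i))
    (hC : ∀ i : ℤ, i ≠ 0 → IsZero (C.homology i))
    (hD : ∀ i : ℤ, i ≠ 0 → IsZero (D.homology i))
    (hC0 : Nonempty ((C.homology 0) ≃ₗ[A] A))
    (hD0 : Nonempty ((D.homology 0) ≃ₗ[A] A)) :
    (∀ i : ℤ, i ≠ 0 → IsZero ((HomologicalComplex.tensorObj C D).homology i)) ∧
      Nonempty (((HomologicalComplex.tensorObj C D).homology 0) ≃ₗ[A] A) := by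
  obtain ⟨u, hu⟩ := (TensorRes.gen_iff D (-1) 0 1 (by norm_num) (by norm_num)).1 hD0
  obtain ⟨v, hv⟩ := (TensorRes.gen_iff C (-1) 0 1 (by norm_num) (by norm_num)).1 hC0
  have main := TensorRes.main C D hCflat hCbdd hDbdd hD u hu
  have dphi := TensorRes.d_phi C D u hu.1
  constructor
  · intro i hi
    rw [TensorRes.isZero_iff _ (i - 1) i (i + 1) (by omega) rfl]
    intro z
    constructor
    · intro hz
      obtain ⟨c, w, hzc, hc⟩ := main (i - 1) i (i + 1) (by omega) rfl 0 z (by rw [hz, map_zero])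
      obtain ⟨c', rfl⟩ := ((TensorRes.isZero_iff C (i - 1) i (i + 1) (by omega) rfl).1 (hC i hi) c).1 hc
      exact ⟨TensorRes.phi C D u (i - 1) c' + w, by rw [map_add, dphi _ _ (by omega), hzc]⟩
    · rintro ⟨w, rfl⟩
      rw [← LinearMap.comp_apply, ← ModuleCat.hom_comp, HomologicalComplex.d_comp_d]; rfl
  · rw [TensorRes.gen_iff _ (-1) 0 1 (by norm_num) (by norm_num)]
    refine ⟨TensorRes.phi C D u 0 v, ?_, ?_, ?_⟩
    · rw [dphi 0 1 (by norm_num), hv.1, map_zero]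
    · intro z hz
      obtain ⟨c, w, hzc, hc⟩ := main (-1) 0 1 (by norm_num) (by norm_num) 0 z (by rw [hz, map_zero])
      obtain ⟨a, y, rfl⟩ := hv.2.1 c hc
      refine ⟨a, TensorRes.phi C D u (-1) y + w, ?_⟩
      rw [hzc, map_add, map_add, map_smul, dphi (-1) 0 (by norm_num)]; abel
    · intro a y h
      obtain ⟨c, w, -, hc⟩ := main (-2) (-1) 0 (by norm_num) (by norm_num) (a • v) y
        (by rw [← h, map_smul])
      exact hv.2.2 a c hc.symm
end

section
/- Let A be a commutative ring, let C be a bounded cochain complex of flat A-modules (C^i = 0 for all but finitely many i), and let F be an acyclic cochain complex of A-modules. Then the tensor product complex C ⊗_A F is acyclic. -/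
open CategoryTheory Limits MonoidalCategory

variable {A : Type} [CommRing A]

namespace TensorAcyclicAux

open HomologicalComplex

variable (C F : CochainComplex (ModuleCat A) ℤ)

/-- Inclusion of a summand. -/
noncomputable def inc (i j n : ℤ) (h : i + j = n) :
    C.X i ⊗ F.X j ⟶ (HomologicalComplex.tensorObj C F).X n := ιTensorObj C F i j n h

/-- Projection to a summand. -/
noncomputable def proj (n i j : ℤ) :
    (HomologicalComplex.tensorObj C F).X n ⟶ C.X i ⊗ F.X j :=
  mapBifunctorDesc (K₁ := C) (K₂ := F) (F := curriedTensor (ModuleCat A))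
    (c := ComplexShape.up ℤ) (fun i₁ i₂ _ =>
      if h : i₁ = i ∧ i₂ = j then
        eqToHom (by obtain ⟨rfl, rfl⟩ := h; rfl) else 0)

variable {C F}

lemma hom_ext' {Y : ModuleCat A} {n : ℤ} {f g : (HomologicalComplex.tensorObj C F).X n ⟶ Y}
    (h : ∀ i j hij, inc C F i j n hij ≫ f = inc C F i j n hij ≫ g) : f = g :=
  mapBifunctor.hom_ext (fun i j hij => h i j hij)

lemma inc_proj (i j n : ℤ) (h : i + j = n) : inc C F i j n h ≫ proj C F n i j = 𝟙 _ := by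
  refine (ι_mapBifunctorDesc _ _ _ _).trans ?_
  simp

lemma inc_proj_ne (i j n : ℤ) (h : i + j = n) (i' j' : ℤ) (hne : i ≠ i') :
    inc C F i j n h ≫ proj C F n i' j' = 0 := by
  refine (ι_mapBifunctorDesc _ _ _ _).trans ?_
  simp [hne]

lemma inc_d (i j n : ℤ) (h : i + j = n) :
    inc C F i j n h ≫ (HomologicalComplex.tensorObj C F).d n (n + 1) =
      (C.d i (i + 1) ▷ F.X j) ≫ inc C F (i + 1) j (n + 1) (by omega) +
      ComplexShape.ε₂ (.up ℤ) (.up ℤ) (.up ℤ) (i, j) •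
        ((C.X i ◁ F.d j (j + 1)) ≫ inc C F i (j + 1) (n + 1) (by omega)) := by
  unfold inc
  rw [mapBifunctor.d_eq, Preadditive.comp_add, mapBifunctor.ι_D₁, mapBifunctor.ι_D₂,
    mapBifunctor.d₁_eq C F (curriedTensor (ModuleCat A)) (.up ℤ)
      (show (ComplexShape.up ℤ).Rel i (i + 1) from rfl) j (n + 1) (by change i + 1 + j = _; omega),
    mapBifunctor.d₂_eq C F (curriedTensor (ModuleCat A)) (.up ℤ) i
      (show (ComplexShape.up ℤ).Rel j (j + 1) from rfl) (n + 1)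
      (by change i + (j + 1) = _; omega)]
  congr 1
  exact one_smul _ _

lemma d_proj (n i j : ℤ) (h : i + j = n) :
    (HomologicalComplex.tensorObj C F).d n (n + 1) ≫ proj C F (n + 1) i (j + 1) =
      proj C F n (i - 1) (j + 1) ≫ (C.d (i - 1) i ▷ F.X (j + 1)) +
      ComplexShape.ε₂ (.up ℤ) (.up ℤ) (.up ℤ) (i, j) •
        (proj C F n i j ≫ (C.X i ◁ F.d j (j + 1))) := by
  apply hom_ext'
  intro i' j' h'
  rw [← Category.assoc, inc_d]
  simp only [Preadditive.add_comp, Preadditive.comp_add, Linear.units_smul_comp,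
    Linear.comp_units_smul, Category.assoc]
  by_cases h1 : i' = i
  · subst h1
    obtain rfl : j' = j := by omega
    rw [inc_proj_ne _ _ _ _ _ _ (by omega), inc_proj, ← Category.assoc (inc C F _ _ _ _),
      inc_proj_ne _ _ _ _ _ _ (by omega), ← Category.assoc (inc C F _ _ _ _), inc_proj]
    simp
  · rw [inc_proj_ne _ _ _ _ _ _ h1, ← Category.assoc (inc C F _ _ _ _) (proj C F n i j),
      inc_proj_ne _ _ _ _ _ _ h1]
    by_cases h2 : i' + 1 = i
    · subst h2
      obtain rfl : j' = j + 1 := by omega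
      obtain ⟨k, hk⟩ : ∃ k, i' + 1 - 1 = k := ⟨_, rfl⟩
      have hk' : k = i' := by omega
      rw [hk]
      subst hk'
      rw [inc_proj, ← Category.assoc (inc C F _ _ _ _), inc_proj]
      simp
    · rw [inc_proj_ne _ _ _ _ _ _ h2, ← Category.assoc (inc C F _ _ _ _),
        inc_proj_ne _ _ _ _ _ _ (by omega)]
      simp

lemma decomp (hC : {i : ℤ | ¬ IsZero (C.X i)}.Finite) (n : ℤ) :
    𝟙 ((HomologicalComplex.tensorObj C F).X n) =
      ∑ i ∈ hC.toFinset, proj C F n i (n - i) ≫ inc C F i (n - i) n (by omega) := by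
  apply hom_ext'
  intro i j h
  obtain rfl : j = n - i := by omega
  rw [Preadditive.comp_sum]
  by_cases hi : i ∈ hC.toFinset
  · rw [Finset.sum_eq_single_of_mem i hi]
    · rw [← Category.assoc, inc_proj]; simp
    · intro b _ hb
      rw [← Category.assoc, inc_proj_ne _ _ _ _ _ _ hb.symm]; simp
  · have hz : IsZero (C.X i) := by simpa using hi
    have : IsZero (C.X i ⊗ F.X (n - i)) := by
      exact Functor.map_isZero (tensorRight (F.X (n - i))) hz
    exact this.eq_of_src _ _

lemma row_exact (hF : ∀ i : ℤ, F.ExactAt i) (i j : ℤ) [Module.Flat A (C.X i)]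
    (x : (C.X i ⊗ F.X (j + 1) : ModuleCat A))
    (hx : (C.X i ◁ F.d (j + 1) (j + 1 + 1)) x = 0) :
    ∃ w : (C.X i ⊗ F.X j : ModuleCat A), (C.X i ◁ F.d j (j + 1)) w = x := by
  have h := hF (j + 1)
  rw [HomologicalComplex.exactAt_iff' _ j (j + 1) (j + 1 + 1) (by simp) (by simp)] at h
  rw [ShortComplex.ShortExact.moduleCat_exact_iff_function_exact] at h
  exact (Module.Flat.lTensor_exact (C.X i) h x).1 hx

lemma step (hF : ∀ i : ℤ, F.ExactAt i) (hCflat : ∀ i : ℤ, Module.Flat A (C.X i))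
    (hC : {i : ℤ | ¬ IsZero (C.X i)}.Finite) (b : ℤ) (hb : ∀ i, ¬ IsZero (C.X i) → i < b)
    (n : ℤ) (k : ℕ) : ∀ z : (HomologicalComplex.tensorObj C F).X (n + 1),
      (HomologicalComplex.tensorObj C F).d (n + 1) (n + 1 + 1) z = 0 →
      (∀ i j : ℤ, i < b - k → i + j = n + 1 → proj C F (n + 1) i j z = 0) →
      ∃ w, (HomologicalComplex.tensorObj C F).d n (n + 1) w = z := by
  induction k with
  | zero =>
    intro z _ hz
    refine ⟨0, ?_⟩
    rw [map_zero]
    have := congrArg (fun f => ModuleCat.Hom.hom f z) (decomp (F := F) hC (n + 1))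
    beta_reduce at this
    rw [ModuleCat.hom_sum, LinearMap.sum_apply] at this
    refine (this.trans (Finset.sum_eq_zero ?_)).symm
    intro i hi
    have hi' : i < b := hb i (by simpa using hi)
    simp [hz i (n + 1 - i) (by simpa using hi') (by omega)]
  | succ k ih =>
    intro z hdz hz
    obtain ⟨m, hm⟩ : ∃ m : ℤ, m = b - (k + 1 : ℕ) := ⟨_, rfl⟩
    rw [← hm] at hz
    obtain ⟨j, hj⟩ : ∃ j : ℤ, m + j = n := ⟨n - m, by omega⟩
    have hd := ConcreteCategory.congr_hom
      (d_proj (C := C) (F := F) (n + 1) m (j + 1) (by omega)) z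
    have h0 := hz (m - 1) (j + 1 + 1) (by omega) (by omega)
    have h1 : (C.X m ◁ F.d (j + 1) (j + 1 + 1)) (proj C F (n + 1) m (j + 1) z) = 0 := by
      have h2 : proj C F (n + 1 + 1) m (j + 1 + 1)
          ((HomologicalComplex.tensorObj C F).d (n + 1) (n + 1 + 1) z) = 0 := by
        rw [hdz, map_zero]
      have h3 := hd.symm.trans h2
      rcases Int.units_eq_one_or
        (ComplexShape.ε₂ (.up ℤ) (.up ℤ) (.up ℤ) (m, j + 1)) with h | h <;>
      · rw [h] at h3
        simpa [h0] using h3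
    have := hCflat m
    obtain ⟨w, hw⟩ := row_exact hF m j _ h1
    obtain ⟨e, he⟩ : ∃ e : ℤˣ, e = ComplexShape.ε₂ (.up ℤ) (.up ℤ) (.up ℤ) (m, j) := ⟨_, rfl⟩
    let v := (e • inc C F m j n hj) w
    have hv : ∀ i j', i < m + 1 → i + j' = n + 1 →
        proj C F (n + 1) i j' ((HomologicalComplex.tensorObj C F).d n (n + 1) v) = proj C F (n + 1) i j' z := by
      intro i j' hi hij
      have key : (e • inc C F m j n hj) ≫ (HomologicalComplex.tensorObj C F).d n (n + 1) ≫ proj C F (n + 1) i j' =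
        (C.X m ◁ F.d j (j + 1)) ≫ inc C F m (j + 1) (n + 1) (by omega) ≫
          proj C F (n + 1) i j' := by
        rw [Linear.units_smul_comp, ← Category.assoc, inc_d, Preadditive.add_comp, Category.assoc,
          inc_proj_ne _ _ _ _ _ _ (by omega), ← he, Linear.units_smul_comp, Limits.comp_zero,
          zero_add, smul_smul, Int.units_mul_self, one_smul, Category.assoc]
      have key' := ConcreteCategory.congr_hom key w
      refine key'.trans ?_
      by_cases him : i = m
      · subst him
        obtain rfl : j' = j + 1 := by omega
        rw [inc_proj, Category.comp_id, hw]
      · rw [inc_proj_ne _ _ _ _ _ _ (Ne.symm him), hz i j' (by omega) hij]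
        simp
    obtain ⟨u, hu⟩ := ih (z - (HomologicalComplex.tensorObj C F).d n (n + 1) v) (by
        rw [map_sub, hdz, ← ModuleCat.comp_apply, HomologicalComplex.d_comp_d]; simp) (by
        intro i j' hi hij
        rw [map_sub, hv i j' (by push_cast at hm; omega) hij, sub_self])
    exact ⟨u + v, by rw [map_add, hu]; abel⟩

end TensorAcyclicAux

theorem tensor_acyclic_of_bounded_flat_of_acyclic
    (C F : CochainComplex (ModuleCat A) ℤ)
    (hCflat : ∀ i : ℤ, Module.Flat A (C.X i))
    (hCbounded : {i : ℤ | ¬ IsZero (C.X i)}.Finite)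
    (hF : ∀ i : ℤ, F.ExactAt i) :
    ∀ n : ℤ, (HomologicalComplex.tensorObj C F).ExactAt n := by
  intro n
  obtain ⟨n, rfl⟩ : ∃ m, n = m + 1 := ⟨n - 1, by omega⟩
  rw [HomologicalComplex.exactAt_iff' _ n (n + 1) (n + 1 + 1) (by simp) (by simp),
    ShortComplex.moduleCat_exact_iff]
  intro z hz
  obtain ⟨b, hb⟩ := hCbounded.bddAbove
  obtain ⟨a, ha⟩ := hCbounded.bddBelow
  refine TensorAcyclicAux.step hF hCflat hCbounded (b + 1)
    (fun i hi => by have := hb hi; omega) n (b + 1 - a).toNat z hz ?_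
  intro i j hi _
  have hz : IsZero (C.X i) := by
    by_contra h
    have := ha h
    omega
  have : IsZero (C.X i ⊗ F.X j) := Functor.map_isZero (tensorRight (F.X j)) hz
  rw [this.eq_of_tgt (TensorAcyclicAux.proj C F (n + 1) i j) 0]
  rfl
end

section
/- Let R be a commutative noetherian regular local ring of Krull dimension d, and let M be a cochain complex of finitely generated R-modules with M^i = 0 for i < a or i > b, where a ≤ b are integers. Then there exist a cochain complex P of finitely generated free R-modules with P^i = 0 for i < a − d or i > b, and a quasi-isomorphism of complexes P → M. -/
/-!
STATEMENT 12: Let `R` be a commutative noetherian regular local ring of Krull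
dimension `d` (a noetherian local ring whose maximal ideal is generated by
`d = dim R` elements), and let `M` be a cochain complex of finitely generated
`R`-modules with `M^i = 0` for `i < a` or `i > b` (`a ≤ b`). Then there exist a
cochain complex `P` of finitely generated free `R`-modules with `P^i = 0` for
`i < a - d` or `i > b`, and a quasi-isomorphism `P ⟶ M`.
-/

open CategoryTheory Limits
open IsLocalRing RingTheory.Sequence in
theorem reg_aux (d : ℕ) : ∀ (R : Type) [CommRing R] [IsNoetherianRing R] [IsLocalRing R],
    (d : WithBot ℕ∞) ≤ ringKrullDim R →
    (∃ f : Fin d → R, Ideal.span (Set.range f) = maximalIdeal R) →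
    IsDomain R ∧ ∃ rs : List R, rs.length = d ∧ IsWeaklyRegular R rs ∧
      Ideal.ofList rs = maximalIdeal R := by
  induction d with
  | zero =>
    intro R _ _ _ _ ⟨f, hf⟩
    have h0 : maximalIdeal R = ⊥ := by rw [← hf]; simp
    have hF : IsField R := isField_iff_maximalIdeal_eq.mpr h0
    exact ⟨hF.isDomain, [], rfl, IsWeaklyRegular.nil _ _, by simp [h0]⟩
  | succ d ih =>
    intro R _ _ _ hdim ⟨f, hf⟩
    have hmin : ∀ p ∈ minimalPrimes R, ¬ maximalIdeal R ≤ p := by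
      intro p hp hle
      have : p.IsPrime := hp.1.1
      have hpm : maximalIdeal R = p := le_antisymm hle (le_maximalIdeal this.ne_top)
      rw [← maximalIdeal_height_eq_ringKrullDim, hpm] at hdim
      have hh : p.height = 0 := Ideal.height_eq_zero_iff.mpr hp
      rw [hh] at hdim
      have : ((d+1 : ℕ) : ℕ∞) ≤ 0 := by exact_mod_cast hdim
      simp at this
    have hsq : ¬ maximalIdeal R ≤ maximalIdeal R ^ 2 := by
      intro hle
      have h0 : maximalIdeal R = ⊥ := by
        refine Submodule.eq_bot_of_le_smul_of_le_jacobson_bot (maximalIdeal R) _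
          (IsNoetherian.noetherian _) (by simpa [pow_two] using hle) (maximalIdeal_le_jacobson _)
      obtain ⟨p, hp, -⟩ := Ideal.exists_minimalPrimes_le (I := (⊥ : Ideal R)) (J := maximalIdeal R) bot_le
      exact hmin p hp (by rw [h0]; exact bot_le)
    obtain ⟨x, hxm, hx2, hxp⟩ : ∃ x ∈ maximalIdeal R, x ∉ maximalIdeal R ^ 2 ∧
        ∀ p ∈ minimalPrimes R, x ∉ p := by
      by_contra! hcon
      have hfin := minimalPrimes.finite_of_isNoetherianRing R
      classical
      have := (Ideal.subset_union_prime (s := insert (maximalIdeal R ^ 2) hfin.toFinset) (f := id)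
        (maximalIdeal R ^ 2) (maximalIdeal R ^ 2) (I := maximalIdeal R) (by
          intro p hp h1 _
          simp [h1] at hp
          exact hp.1.1)).1 (by
          intro x hx
          by_cases h2 : x ∈ maximalIdeal R ^ 2
          · simp; left; exact h2
          · obtain ⟨p, hp, hxp⟩ := hcon x hx h2
            simp; right; exact ⟨p, hp, hxp⟩)
      obtain ⟨p, hp, hle⟩ := this
      simp at hp
      rcases hp with rfl | hp
      · exact hsq hle
      · exact hmin p hp hle
    have hfm : ∀ i, f i ∈ maximalIdeal R := fun i => hf ▸ Ideal.subset_span ⟨i, rfl⟩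
    obtain ⟨c, hc⟩ := (Ideal.mem_span_range_iff_exists_fun).1 (hf ▸ hxm)
    obtain ⟨j, hj⟩ : ∃ j, c j ∉ maximalIdeal R := by
      by_contra! hcon
      apply hx2
      rw [← hc, pow_two]
      exact Ideal.sum_mem _ fun i _ => Ideal.mul_mem_mul (hcon i) (hfm i)
    have hju : IsUnit (c j) := by simpa using hj
    obtain ⟨u, hu⟩ := hju
    have hspan : maximalIdeal R = Ideal.span {x} ⊔ Ideal.span (Set.range (f ∘ j.succAbove)) := by
      apply le_antisymm
      · rw [← hf, Ideal.span_le]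
        rintro _ ⟨i, rfl⟩
        have hI : ∀ k, f (j.succAbove k) ∈ Ideal.span {x} ⊔ Ideal.span (Set.range (f ∘ j.succAbove)) :=
          fun k => Ideal.mem_sup_right (Ideal.subset_span ⟨k, rfl⟩)
        rcases Fin.eq_self_or_eq_succAbove j i with rfl | ⟨k, rfl⟩
        · rw [Fin.sum_univ_succAbove _ i] at hc
          have : f i = (↑u⁻¹ : R) * (x - ∑ k, c (i.succAbove k) * f (i.succAbove k)) := by
            rw [← hc, ← hu]; simp
          rw [SetLike.mem_coe, this]
          exact Ideal.mul_mem_left _ _ (Ideal.sub_mem _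
            (Ideal.mem_sup_left (Ideal.mem_span_singleton_self x))
            (Ideal.sum_mem _ fun k _ => Ideal.mul_mem_left _ _ (hI k)))
        · exact hI k
      · refine sup_le ((Ideal.span_singleton_le_iff_mem _).2 hxm) (Ideal.span_le.2 ?_)
        rintro _ ⟨k, rfl⟩
        exact hfm _
    have hne : Ideal.span {x} ≠ ⊤ := fun h => (maximalIdeal.isMaximal R).ne_top
      (top_le_iff.1 (h ▸ (Ideal.span_singleton_le_iff_mem _).2 hxm))
    have : Nontrivial (R ⧸ Ideal.span {x}) := Ideal.Quotient.nontrivial_iff.2 hne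
    have hloc : IsLocalRing (R ⧸ Ideal.span {x}) :=
      IsLocalRing.of_surjective' (Ideal.Quotient.mk _) Ideal.Quotient.mk_surjective
    have hmap : (maximalIdeal R).map (Ideal.Quotient.mk (Ideal.span {x})) =
        maximalIdeal (R ⧸ Ideal.span {x}) := by
      apply IsLocalRing.eq_maximalIdeal
      have := maximalIdeal.isMaximal R
      refine (Ideal.map_eq_top_or_isMaximal_of_surjective _ Ideal.Quotient.mk_surjective this).resolve_left ?_
      intro h
      have h1 := congrArg (Ideal.comap (Ideal.Quotient.mk (Ideal.span {x}))) h
      rw [Ideal.comap_map_of_surjective _ Ideal.Quotient.mk_surjective, ← RingHom.ker_eq_comap_bot,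
        Ideal.mk_ker, Ideal.comap_top, sup_eq_left.2 ((Ideal.span_singleton_le_iff_mem _).2 hxm)] at h1
      exact this.ne_top h1
    have hxmap : Ideal.map (Ideal.Quotient.mk (Ideal.span {x})) (Ideal.span {x}) = ⊥ := by simp
    obtain ⟨hdom, rs', hlen, hreg, hrs⟩ := ih (R ⧸ Ideal.span {x}) (by
        have h1 := ringKrullDim_le_ringKrullDim_quotient_add_card ({x} : Finset R)
          (by rw [ringJacobson_eq_maximalIdeal]; simpa using hxm)
        rw [Finset.coe_singleton, Finset.card_singleton] at h1
        have h2 := hdim.trans h1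
        push_cast at h2
        have h3 : ((d : ℕ) : WithBot ℕ∞) + ((1:ℕ) : WithBot ℕ∞) ≤
          ringKrullDim (R ⧸ Ideal.span {x}) + ((1:ℕ) : WithBot ℕ∞) := by simpa using h2
        exact ENat.WithBot.add_le_add_natCast_right_iff.1 h3)
      ⟨Ideal.Quotient.mk _ ∘ f ∘ j.succAbove, by
        rw [← hmap, hspan, Ideal.map_sup, hxmap, bot_sup_eq, Ideal.map_span, ← Set.range_comp]⟩
    have hxprime : (Ideal.span {x}).IsPrime := (Ideal.Quotient.isDomain_iff_prime _).1 hdom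
    have hdomR : IsDomain R := by
      obtain ⟨p, hp, hple⟩ := Ideal.exists_minimalPrimes_le (I := (⊥ : Ideal R)) (J := Ideal.span {x}) bot_le
      have hpp : p.IsPrime := hp.1.1
      have : p = ⊥ := by
        refine Submodule.eq_bot_of_le_smul_of_le_jacobson_bot (maximalIdeal R) _
          (IsNoetherian.noetherian _) ?_ (maximalIdeal_le_jacobson _)
        intro y hy
        obtain ⟨r, rfl⟩ := Ideal.mem_span_singleton.1 (hple hy)
        exact Ideal.mul_mem_mul hxm ((hpp.mem_or_mem hy).resolve_left (hxp p hp))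
      exact IsDomain.of_bot_isPrime R (hbp := this ▸ hpp)
    refine ⟨hdomR, ?_⟩
    obtain ⟨rs, rfl⟩ : ∃ rs : List R, rs.map (Ideal.Quotient.mk (Ideal.span {x})) = rs' :=
      ⟨rs'.map (Function.surjInv Ideal.Quotient.mk_surjective), by
        simp [Function.comp_def, Function.surjInv_eq]⟩
    refine ⟨x :: rs, by simpa using hlen, ?_, ?_⟩
    · have hx0 : x ≠ 0 := fun h => hx2 (h ▸ Ideal.zero_mem _)
      refine IsWeaklyRegular.cons ?_ ?_
      · intro a b hab
        exact mul_left_cancel₀ hx0 hab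
      · have h1 : IsWeaklyRegular (R ⧸ Ideal.span {x}) rs :=
          (isWeaklyRegular_map_algebraMap_iff (R ⧸ Ideal.span {x}) (R ⧸ Ideal.span {x}) rs).1 hreg
        refine (LinearEquiv.isWeaklyRegular_congr (Submodule.quotEquivOfEq _ _ ?_) rs).1 h1
        rw [← Submodule.ideal_span_singleton_smul]; simp
    · rw [Ideal.ofList_cons]
      have := congrArg (Ideal.comap (Ideal.Quotient.mk (Ideal.span {x}))) hrs
      rw [← Ideal.map_ofList, ← hmap, Ideal.comap_map_of_surjective _ Ideal.Quotient.mk_surjective,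
        Ideal.comap_map_of_surjective _ Ideal.Quotient.mk_surjective, ← RingHom.ker_eq_comap_bot,
        Ideal.mk_ker, sup_eq_left.2 ((Ideal.span_singleton_le_iff_mem _).2 hxm)] at this
      rw [sup_comm, this]

open IsLocalRing CategoryTheory.Abelian in
theorem nak_aux {R : Type} [CommRing R] [IsNoetherianRing R] [IsLocalRing R]
    (N L : ModuleCat.{0} R) [Module.Finite R N] [Module.Finite R L] (x : R)
    (hr : IsSMulRegular N x) (hxm : x ∈ maximalIdeal R) (i : ℕ)
    (zero : Subsingleton (Ext (ModuleCat.of R (QuotSMulTop x N)) L (i+1))) :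
    Subsingleton (Ext N L i) := by
  have hS := IsSMulRegular.smulShortComplex_shortExact hr
  by_contra! ntr
  have : x ∈ (Module.annihilator R (Ext N L i)).jacobson :=
    (IsLocalRing.maximalIdeal_le_jacobson _) hxm
  absurd Submodule.top_ne_pointwise_smul_of_mem_jacobson_annihilator this
  rw [eq_comm, eq_top_iff]
  intro y hy
  have hz : ∃ z : Ext N L i, (Ext.mk₀ (x • 𝟙 N)).comp z (zero_add i) = y :=
    Ext.contravariant_sequence_exact₁ hS L y (add_comm 1 i) (zero.elim _ _)
  obtain ⟨z, hz⟩ := hz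
  rw [Ext.mk₀_smul, Ext.smul_comp, Ext.mk₀_id_comp] at hz
  rw [← hz]
  exact Submodule.smul_mem_pointwise_smul _ _ ⊤ trivial

open IsLocalRing RingTheory.Sequence CategoryTheory.Abelian in
theorem gldim_aux {R : Type} [CommRing R] [IsNoetherianRing R] [IsLocalRing R] (rs : List R)
    (hreg : IsWeaklyRegular R rs) (hrs : Ideal.ofList rs = maximalIdeal R) (I : Ideal R) :
    ∀ (N : Type) [AddCommGroup N] [Module R N] [Module.Finite R N], I ≤ Module.annihilator R N →
    ∀ (L : ModuleCat.{0} R) [Module.Finite R L] (i : ℕ), rs.length < i →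
      Subsingleton (Ext (ModuleCat.of R N) L i) := by
  induction I using WellFoundedGT.induction with
  | ind I ih =>
  intro N _ _ hN
  induction hN using IsNoetherianRing.induction_on_isQuotientEquivQuotientPrime R with
  | subsingleton N =>
    intro _ L _ i hi
    have : IsZero (ModuleCat.of R N) := ModuleCat.isZero_of_subsingleton _
    have := this.hasProjectiveDimensionLT_zero
    exact HasProjectiveDimensionLT.subsingleton _ 0 i (by simp) L
  | quotient N p e =>
    intro hI L _ i hi
    have hann : Module.annihilator R N = p.1 := by
      rw [e.annihilator_eq, Ideal.annihilator_quotient]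
    by_cases hpm : maximalIdeal R ≤ p.1
    · have hp : p.1 = maximalIdeal R := le_antisymm (le_maximalIdeal p.2.ne_top) hpm
      have h1 := ModuleCat.projectiveDimension_quotient_eq_add_length_of_isWeaklyRegular
        (ModuleCat.of R R) rs hreg (fun r hr => hrs ▸ Ideal.subset_span hr)
      rw [ModuleCat.projectiveDimension_eq_zero_of_projective (ModuleCat.of R R), zero_add] at h1
      have h2 := (projectiveDimension_le_iff _ _).1 h1.le
      have h3 : HasProjectiveDimensionLE (ModuleCat.of R N) rs.length := by
        refine ModuleCat.hasProjectiveDimensionLE_of_linearEquiv (M := ModuleCat.of R (R ⧸ Ideal.ofList rs • (⊤ : Submodule R R))) 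
          ((Submodule.quotEquivOfEq _ _ ?_).trans e.symm) rs.length
        rw [hp, hrs]; simp
      exact HasProjectiveDimensionLT.subsingleton _ (rs.length + 1) i (by omega) L
    · obtain ⟨x, hxm, hxp⟩ := SetLike.not_le_iff_exists.1 hpm
      have hr : IsSMulRegular N x := by
        rw [e.isSMulRegular_congr]
        have := p.2
        intro a b hab
        refine mul_left_cancel₀ (a := Ideal.Quotient.mk p.1 x) ?_ hab
        rwa [Ne, Ideal.Quotient.eq_zero_iff_mem]
      have zero : Subsingleton (Ext (ModuleCat.of R (QuotSMulTop x N)) L (i+1)) := by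
        refine ih (I ⊔ Ideal.span {x}) ?_ _ ?_ L (i+1) (by omega)
        · refine lt_of_le_of_ne le_sup_left fun h => hxp ?_
          rw [← hann]
          apply hI
          rw [h]
          exact Ideal.mem_sup_right (Ideal.mem_span_singleton_self x)
        · refine sup_le (hI.trans ?_) ((Ideal.span_singleton_le_iff_mem _).2 (QuotSMulTop.mem_annihilator N x))
          exact LinearMap.annihilator_le_of_surjective (Submodule.mkQ _) (Submodule.mkQ_surjective _)
      exact nak_aux (ModuleCat.of R N) L x hr hxm i zero
  | exact N₁ N₂ N₃ f g hf hg hfg h₁ h₃ =>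
    intro hI L _ i hi
    let S : ShortComplex (ModuleCat R) := ModuleCat.shortComplexOfCompEqZero f g hfg.linearMap_comp_eq_zero
    have hS : S.ShortExact :=
      { exact := ModuleCat.shortComplex_exact _ hfg
        mono_f := (ModuleCat.mono_iff_injective _).2 hf
        epi_g := (ModuleCat.epi_iff_surjective _).2 hg }
    have z1 := h₁ (hI.trans (f.annihilator_le_of_injective hf)) L i hi
    have z3 := h₃ (hI.trans (g.annihilator_le_of_surjective hg)) L i hi
    refine subsingleton_of_forall_eq 0 fun y => ?_
    obtain ⟨z, hz⟩ := Ext.contravariant_sequence_exact₂ hS L y (z1.elim _ _)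
    rw [← hz, z3.elim z 0]; simp

open IsLocalRing RingTheory.Sequence in
theorem gldim {R : Type} [CommRing R] [IsNoetherianRing R] [IsLocalRing R] (rs : List R)
    (hreg : IsWeaklyRegular R rs) (hrs : Ideal.ofList rs = maximalIdeal R)
    (N : ModuleCat.{0} R) [Module.Finite R N] : HasProjectiveDimensionLT N (rs.length + 1) :=
  ModuleCat.hasProjectiveDimensionLT_of_forall_finite N _ fun L _ =>
    gldim_aux rs hreg hrs ⊥ N bot_le L _ (by omega)


section Step
variable {C : Type*} [Category C] [Abelian C]

theorem relpred (n : ℤ) : (ComplexShape.up ℤ).Rel (n-1) n := by simp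

open HomologicalComplex ZeroObject

theorem disk_acyclic (A : C) (n : ℤ) : (double (𝟙 A) (relpred n)).Acyclic := by
  intro j
  have hne : n - 1 ≠ n := by omega
  have hiso : IsIso ((double (𝟙 A) (relpred n)).d (n-1) n) := by
    rw [double_d _ _ hne]; infer_instance
  by_cases h1 : j = n
  · subst h1
    rw [exactAt_iff' _ (j-1) j (j+1) (by simp) (by simp)]
    refine (ShortComplex.exact_iff_epi _ ?_).2 ?_
    · exact double_d_eq_zero₀ _ (relpred j) _ _ hne.symm
    · exact inferInstanceAs (Epi ((double (𝟙 A) (relpred j)).d (j-1) j))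
  by_cases h2 : j = n - 1
  · subst h2
    rw [exactAt_iff' _ (n-1-1) (n-1) n (by simp) (by simp)]
    refine (ShortComplex.exact_iff_mono _ ?_).2 ?_
    · exact double_d_eq_zero₁ _ (relpred n) _ _ hne
    · exact inferInstanceAs (Mono ((double (𝟙 A) (relpred n)).d (n-1) n))
  · exact ShortComplex.exact_of_isZero_X₂ _ (isZero_double_X (𝟙 A) (relpred n) _ h2 h1)

noncomputable def toDisk (N : CochainComplex C ℤ) (n : ℤ) :
    N ⟶ double (𝟙 (N.X n)) (relpred n) where
  f k := if h0 : k = n - 1 then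
      eqToHom (by rw [h0]) ≫ N.d (n-1) n ≫ (doubleXIso₀ (𝟙 (N.X n)) (relpred n)).inv ≫ eqToHom (by rw [h0])
    else if h1 : k = n then
      eqToHom (by rw [h1]) ≫ (doubleXIso₁ (𝟙 (N.X n)) (relpred n) (by omega)).inv ≫ eqToHom (by rw [h1])
    else 0
  comm' i j hij := by
    obtain rfl : i + 1 = j := hij
    by_cases h1 : i + 1 = n
    · subst h1
      obtain ⟨k, rfl⟩ : ∃ k, i = k := ⟨_, rfl⟩
      have h2 : i = i + 1 - 1 := by omega
      rw [dif_pos h2, dif_neg (by omega), dif_pos rfl]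
      have : ∀ (m : ℤ) (h : i = m) (hm : (ComplexShape.up ℤ).Rel m (i+1)) (hne : m ≠ i + 1),
        (eqToHom (by rw [h]) ≫ N.d m (i+1) ≫ (doubleXIso₀ (𝟙 (N.X (i+1))) hm).inv ≫ eqToHom (by subst h; rfl)) ≫
          (double (𝟙 (N.X (i+1))) hm).d i (i+1) = N.d i (i+1) ≫ eqToHom rfl ≫ (doubleXIso₁ (𝟙 (N.X (i+1))) hm hne).inv ≫ eqToHom rfl := by
        rintro _ rfl hm hne
        simp [double_d _ hm hne]
      exact this _ h2 (relpred _) (by omega)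
    · rw [double_d_eq_zero₁ _ _ _ _ h1, comp_zero]
      by_cases h2 : i + 1 = n - 1
      · rw [dif_pos h2]
        have : ∀ (m : ℤ) (h : i + 1 = m), N.d i (i+1) ≫ eqToHom (by rw [h]) ≫ N.d m n = 0 := by
          rintro _ rfl; simp
        rw [reassoc_of% this _ h2]; simp
      · rw [dif_neg h2, dif_neg h1, comp_zero]

theorem toDisk_f0 (N : CochainComplex C ℤ) (n : ℤ) : (toDisk N n).f (n-1) =
    N.d (n-1) n ≫ (doubleXIso₀ (𝟙 (N.X n)) (relpred n)).inv := by
  simp [toDisk]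

theorem toDisk_f1 (N : CochainComplex C ℤ) (n : ℤ) : (toDisk N n).f n =
    (doubleXIso₁ (𝟙 (N.X n)) (relpred n) (by omega)).inv := by
  have : n ≠ n - 1 := by omega
  simp [toDisk, this]

noncomputable def diskMap {A B : C} (p : A ⟶ B) (n : ℤ) :
    double (𝟙 A) (relpred n) ⟶ double (𝟙 B) (relpred n) :=
  mkHomFromDouble _ (by omega) (p ≫ (doubleXIso₀ (𝟙 B) (relpred n)).inv)
    (p ≫ (doubleXIso₁ (𝟙 B) (relpred n) (by omega)).inv)
    (by rw [double_d _ _ (by omega)]; simp)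
    (fun k hk => by rw [double_d_eq_zero₀ _ _ _ _ (by omega), comp_zero])

theorem diskMap_f0 {A B : C} (p : A ⟶ B) (n : ℤ) : (diskMap p n).f (n-1) =
    (doubleXIso₀ (𝟙 A) (relpred n)).hom ≫ p ≫ (doubleXIso₀ (𝟙 B) (relpred n)).inv := by
  simp [diskMap]

theorem diskMap_f1 {A B : C} (p : A ⟶ B) (n : ℤ) : (diskMap p n).f n =
    (doubleXIso₁ (𝟙 A) (relpred n) (by omega)).hom ≫ p ≫
      (doubleXIso₁ (𝟙 B) (relpred n) (by omega)).inv := by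
  simp [diskMap]

instance diskMap_epi {A B : C} (p : A ⟶ B) [Epi p] (n : ℤ) : Epi (diskMap p n) := by
  have : ∀ k, Epi ((diskMap p n).f k) := by
    intro k
    by_cases h1 : k = n
    · subst h1; rw [diskMap_f1]; infer_instance
    by_cases h0 : k = n - 1
    · subst h0; rw [diskMap_f0]; infer_instance
    · exact (isZero_double_X _ _ _ h0 h1).epi _
  exact HomologicalComplex.epi_of_epi_f _ this

theorem quasiIso_of_acyclic {K L : CochainComplex C ℤ} (f : K ⟶ L) (hK : K.Acyclic)
    (hL : L.Acyclic) : QuasiIso f where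
  quasiIsoAt i := (quasiIsoAt_iff_exactAt f i (hK i)).2 (hL i)

theorem quasiIso_of_kernel_acyclic {K L : CochainComplex C ℤ} (f : K ⟶ L) [Epi f]
    (h : (kernel f).Acyclic) : QuasiIso f := by
  let S₁ : ShortComplex (CochainComplex C ℤ) := ShortComplex.mk (0 : (0 : CochainComplex C ℤ) ⟶ K) (𝟙 K) (by simp)
  let S₂ : ShortComplex (CochainComplex C ℤ) := ShortComplex.mk (kernel.ι f) f (by simp)
  let φ : S₁ ⟶ S₂ := { τ₁ := 0, τ₂ := 𝟙 K, τ₃ := f }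
  have h1 : S₁.ShortExact :=
    { exact := (ShortComplex.exact_iff_mono _ rfl).2 (by dsimp [S₁]; infer_instance)
      mono_f := (isZero_zero _).mono _
      epi_g := by dsimp [S₁]; infer_instance }
  have h2 : S₂.ShortExact :=
    { exact := ShortComplex.exact_kernel f
      mono_f := by dsimp [S₂]; infer_instance
      epi_g := by dsimp [S₂]; infer_instance }
  refine HomologicalComplex.HomologySequence.quasiIso_τ₃ φ h1 h2 (quasiIso_of_acyclic _ ?_ h) ?_
  · intro i
    exact ShortComplex.exact_of_isZero_X₂ _ ((HomologicalComplex.eval C _ i).map_isZero (isZero_zero _))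
  · dsimp [φ]; infer_instance

theorem quasiIso_pullback {X Y Z W : CochainComplex C ℤ} {f : W ⟶ X} {g : W ⟶ Y} {h : X ⟶ Z}
    {k : Y ⟶ Z} (sq : IsPullback f g h k) [Epi k] [QuasiIso k] : QuasiIso f := by
  have hf : Epi f := Abelian.epi_fst_of_isLimit _ _ sq.isLimit
  have hk : (kernel k).Acyclic := ShortComplex.ShortExact.acyclic_X₁
    (S := ShortComplex.mk (kernel.ι k) k (by simp))
    { exact := ShortComplex.exact_kernel k
      mono_f := by dsimp; infer_instance
      epi_g := by dsimp; infer_instance } (by dsimp; infer_instance)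
  apply quasiIso_of_kernel_acyclic
  have := isIso_kernel_map_of_isPullback sq
  intro i
  exact (exactAt_iff_of_quasiIsoAt (kernel.map _ _ _ _ sq.w) i).2 (hk i)

theorem step_aux (N : CochainComplex C ℤ) (n : ℤ) (F : C) (p : F ⟶ N.X n) [Epi p] :
    ∃ (N' : CochainComplex C ℤ) (q : N' ⟶ N), QuasiIso q ∧ Nonempty (N'.X n ≅ F) ∧
      (∀ i, i ≠ n → i ≠ n - 1 → Nonempty (N'.X i ≅ N.X i)) ∧
      ∃ s : N'.X (n-1) ⟶ F, IsPullback (q.f (n-1)) s (N.d (n-1) n) p := by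
  have sq := IsPullback.of_hasPullback (toDisk N n) (diskMap p n)
  have sqi (i : ℤ) : IsPullback ((pullback.fst (toDisk N n) (diskMap p n)).f i)
      ((pullback.snd (toDisk N n) (diskMap p n)).f i) ((toDisk N n).f i) ((diskMap p n).f i) :=
    sq.map (HomologicalComplex.eval C _ i)
  have : QuasiIso (diskMap p n) := quasiIso_of_acyclic _ (disk_acyclic _ _) (disk_acyclic _ _)
  refine ⟨pullback (toDisk N n) (diskMap p n), pullback.fst _ _, quasiIso_pullback sq, ?_, ?_, ?_⟩
  · have h : IsIso ((toDisk N n).f n) := by rw [toDisk_f1]; infer_instance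
    have := (sqi n).isIso_snd_of_isIso h
    exact ⟨asIso ((pullback.snd (toDisk N n) (diskMap p n)).f n) ≪≫ doubleXIso₁ _ _ (by omega)⟩
  · intro i h1 h0
    have h : IsIso ((diskMap p n).f i) :=
      isIso_of_source_target_iso_zero _ (isZero_double_X _ _ _ h0 h1).isoZero
        (isZero_double_X _ _ _ h0 h1).isoZero
    have := (sqi i).isIso_fst_of_isIso h
    exact ⟨asIso ((pullback.fst (toDisk N n) (diskMap p n)).f i)⟩
  · refine ⟨(pullback.snd (toDisk N n) (diskMap p n)).f (n-1) ≫ (doubleXIso₀ (𝟙 F) (relpred n)).hom, ?_⟩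
    refine IsPullback.of_iso (sqi (n-1)) (Iso.refl _) (Iso.refl _) (doubleXIso₀ _ (relpred n))
      (doubleXIso₀ _ (relpred n)) ?_ ?_ ?_ ?_
    · exact (Category.comp_id _).trans (Category.id_comp _).symm
    · exact (Category.id_comp _).symm
    · simp [toDisk_f0]
    · simp [diskMap_f0]
end Step

theorem shortExact_of_isPullback {C : Type*} [Category C] [Abelian C] {W X Y Z : C}
    {f : W ⟶ X} {s : W ⟶ Y} {h : X ⟶ Z} {p : Y ⟶ Z} (sq : IsPullback f s h p) (hX : IsZero X)
    [Epi p] : ∃ w : s ≫ p = 0, (ShortComplex.mk s p w).ShortExact := by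
  have w : s ≫ p = 0 := by rw [← sq.w, hX.eq_of_tgt f 0, zero_comp]
  have hm : Mono s := ⟨fun u v huv => sq.hom_ext (hX.eq_of_tgt _ _) huv⟩
  refine ⟨w, { exact := ShortComplex.exact_of_f_is_kernel _ ?_, mono_f := hm, epi_g := ‹_› }⟩
  exact KernelFork.IsLimit.ofι' s w fun {A} k hk => ⟨sq.lift 0 k (by simpa using hk.symm), by simp⟩

universe v

theorem finite_of_isPullback {R : Type} [CommRing R] [IsNoetherianRing R] {W X Y Z : ModuleCat.{v} R}
    {f : W ⟶ X} {s : W ⟶ Y} {h : X ⟶ Z} {p : Y ⟶ Z} (sq : IsPullback f s h p)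
    [Module.Finite R X] [Module.Finite R Y] : Module.Finite R W := by
  have hm : Mono (ModuleCat.ofHom (f.hom.prod s.hom)) := by
    refine ⟨fun u v huv => sq.hom_ext ?_ ?_⟩
    · have := congrArg (· ≫ ModuleCat.ofHom (LinearMap.fst R X Y)) huv
      simpa [← ModuleCat.ofHom_comp] using this
    · have := congrArg (· ≫ ModuleCat.ofHom (LinearMap.snd R X Y)) huv
      simpa [← ModuleCat.ofHom_comp] using this
  exact Module.Finite.of_injective (f.hom.prod s.hom) ((ModuleCat.mono_iff_injective _).1 hm)

theorem main_aux
    (R : Type) [CommRing R] [IsNoetherianRing R] [IsLocalRing R]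
    (d : ℕ) (hdim : ringKrullDim R = d)
    (hreg : ∃ s : Finset R, s.card = d ∧ Ideal.span (s : Set R) = IsLocalRing.maximalIdeal R)
    (M : CochainComplex (ModuleCat.{v} R) ℤ)
    (hfg : ∀ i : ℤ, Module.Finite R (M.X i))
    (a b : ℤ) (hab : a ≤ b)
    (hbdd : ∀ i : ℤ, (i < a ∨ b < i) → IsZero (M.X i)) :
    ∃ (P : CochainComplex (ModuleCat.{v} R) ℤ) (π : P ⟶ M),
      (∀ i : ℤ, Module.Free R (P.X i) ∧ Module.Finite R (P.X i)) ∧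
      (∀ i : ℤ, (i < a - d ∨ b < i) → IsZero (P.X i)) ∧
      QuasiIso π := by
  have hgl : ∀ N : ModuleCat.{v} R, Module.Finite R N → HasProjectiveDimensionLT N (d + 1) := by
    obtain ⟨s, hs, hspan⟩ := hreg
    obtain ⟨-, rs, hlen, hrs, hm⟩ := reg_aux d R hdim.ge
      ⟨fun i => (s.equivFinOfCardEq hs).symm i, by
        rw [← hspan]
        congr 1
        ext x
        constructor
        · rintro ⟨i, rfl⟩
          exact ((s.equivFinOfCardEq hs).symm i).2
        · intro hx
          exact ⟨s.equivFinOfCardEq hs ⟨x, hx⟩, by simp⟩⟩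
    intro N _
    rw [← hlen]
    obtain ⟨r, g, hg⟩ := Module.Finite.exists_fin' R N
    have h0 : HasProjectiveDimensionLE (ModuleCat.of R ((Fin r → R) ⧸ LinearMap.ker g)) rs.length :=
      gldim rs hrs hm _
    exact ModuleCat.hasProjectiveDimensionLE_of_linearEquiv.{0, v}
      (M := ModuleCat.of R ((Fin r → R) ⧸ LinearMap.ker g)) (g.quotKerEquivOfSurjective hg) rs.length
  have hfree0 : ∀ N : ModuleCat.{v} R, IsZero N → Module.Free R N := by
    intro N hN
    have := ModuleCat.subsingleton_of_isZero hN
    exact Module.Free.of_subsingleton R N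
  have key : ∀ n : ℤ, n ≤ b → (a - d ≤ n →
      ∃ (N : CochainComplex (ModuleCat.{v} R) ℤ) (q : N ⟶ M), QuasiIso q ∧
        (∀ i, Module.Finite R (N.X i)) ∧ (∀ i, n < i → Module.Free R (N.X i)) ∧
        (∀ i, b < i → IsZero (N.X i)) ∧ (∀ i, i < a → i < n → IsZero (N.X i)) ∧
        HasProjectiveDimensionLT (N.X n) (d + 1 - a + n).toNat) := by
    intro n hn
    induction n, hn using Int.le_induction_down with
    | base =>
      intro _
      refine ⟨M, 𝟙 M, inferInstance, hfg, fun i hi => hfree0 _ (hbdd i (Or.inr hi)),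
        fun i hi => hbdd i (Or.inr hi), fun i hi _ => hbdd i (Or.inl hi), ?_⟩
      have := hgl _ (hfg b)
      exact hasProjectiveDimensionLT_of_ge _ (d+1) _ (by omega)
    | pred n hn ih =>
      intro han
      obtain ⟨N, q, hq, hfin, hfree, hzb, hza, hpd⟩ := ih (by omega)
      have := hfin n
      obtain ⟨r, g, hg⟩ := Module.Finite.exists_fin' R (N.X n)
      have hFfin : Module.Finite R (ULift.{v} (Fin r → R)) :=
        Module.Finite.equiv ULift.moduleEquiv.symm
      have hFfree : Module.Free R (ULift.{v} (Fin r → R)) :=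
        Module.Free.of_equiv ULift.moduleEquiv.symm
      let F : ModuleCat.{v} R := ModuleCat.of R (ULift.{v} (Fin r → R))
      have hF : Projective F :=
        (IsProjective.iff_projective _).1
          (inferInstanceAs (Module.Projective R (ULift.{v} (Fin r → R))))
      let p : F ⟶ N.X n := ModuleCat.ofHom (g ∘ₗ ULift.moduleEquiv.toLinearMap)
      have hp : Epi p := (ModuleCat.epi_iff_surjective _).2
        (hg.comp ULift.moduleEquiv.surjective)
      obtain ⟨N', q', hq', ⟨e⟩, he, s, sq⟩ := step_aux N n F p
      have hfin1 : Module.Finite R (N'.X (n-1)) := by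
        have := hfin (n-1)
        exact finite_of_isPullback sq
      refine ⟨N', q' ≫ q, inferInstance, ?_, ?_, ?_, ?_, ?_⟩
      · intro i
        by_cases h1 : i = n
        · subst h1
          exact Module.Finite.equiv e.symm.toLinearEquiv
        by_cases h0 : i = n - 1
        · subst h0; exact hfin1
        obtain ⟨e'⟩ := he i h1 h0
        have := hfin i
        exact Module.Finite.equiv e'.symm.toLinearEquiv
      · intro i hi
        by_cases h1 : i = n
        · subst h1
          exact Module.Free.of_equiv e.symm.toLinearEquiv
        obtain ⟨e'⟩ := he i h1 (by omega)
        have := hfree i (by omega)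
        exact Module.Free.of_equiv e'.symm.toLinearEquiv
      · intro i hi
        obtain ⟨e'⟩ := he i (by omega) (by omega)
        exact (hzb i hi).of_iso e'
      · intro i hi hi'
        obtain ⟨e'⟩ := he i (by omega) (by omega)
        exact (hza i hi (by omega)).of_iso e'
      · by_cases hna : a ≤ n - 1
        · have := hgl _ hfin1
          exact hasProjectiveDimensionLT_of_ge _ (d+1) _ (by omega)
        · obtain ⟨w, hS⟩ := shortExact_of_isPullback sq (hza (n-1) (by omega) (by omega))
          obtain ⟨m, hm⟩ : ∃ m : ℕ, (d + 1 - a + n : ℤ) = m + 2 :=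
            ⟨(d - 1 - a + n).toNat, by omega⟩
          have e1 : (d + 1 - a + n : ℤ).toNat = m + 2 := by omega
          have e2 : (d + 1 - a + (n - 1) : ℤ).toNat = m + 1 := by omega
          rw [e2]
          rw [e1] at hpd
          exact (hS.hasProjectiveDimensionLT_X₃_iff m hF).1 hpd
  obtain ⟨P, π, hq, hfin, hfree, hzb, hza, hpd⟩ := key (a - d) (by omega) le_rfl
  have hz : ∀ i : ℤ, (i < a - d ∨ b < i) → IsZero (P.X i) := by
    rintro i (hi | hi)
    · exact hza i (by omega) hi
    · exact hzb i hi
  refine ⟨P, π, fun i => ⟨?_, hfin i⟩, hz, hq⟩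
  rcases lt_trichotomy i (a - d) with hi | hi | hi
  · exact hfree0 _ (hz i (Or.inl hi))
  · subst hi
    have e1 : (d + 1 - a + (a - d) : ℤ).toNat = 1 := by omega
    rw [e1] at hpd
    have := hfin (a - d)
    have h2 := projective_iff_hasProjectiveDimensionLT_one.2 hpd
    have : Module.Projective R (P.X (a - d)) := (IsProjective.iff_projective _).2 h2
    exact Module.free_of_flat_of_isLocalRing
  · exact hfree i hi

theorem exists_bounded_free_resolution_of_regular_local
    (R : Type) [CommRing R] [IsNoetherianRing R] [IsLocalRing R]
    (d : ℕ) (hdim : ringKrullDim R = d)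
    (hreg : ∃ s : Finset R, s.card = d ∧ Ideal.span (s : Set R) = IsLocalRing.maximalIdeal R)
    (M : CochainComplex (ModuleCat R) ℤ)
    (hfg : ∀ i : ℤ, Module.Finite R (M.X i))
    (a b : ℤ) (hab : a ≤ b)
    (hbdd : ∀ i : ℤ, (i < a ∨ b < i) → IsZero (M.X i)) :
    ∃ (P : CochainComplex (ModuleCat R) ℤ) (π : P ⟶ M),
      (∀ i : ℤ, Module.Free R (P.X i) ∧ Module.Finite R (P.X i)) ∧
      (∀ i : ℤ, (i < a - d ∨ b < i) → IsZero (P.X i)) ∧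
      QuasiIso π := by
  exact main_aux R d hdim hreg M hfg a b hab hbdd
end
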